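/- arXiv:1411.5083 — 2 statements merged into one kernel-verified Lean document; each statement's English description precedes it below -/
import Mathlib

section
/- (Stationary phase expansion for T₁.) Let ε > 0, ρ ∈ [0,1/2), k₀ ∈ ℝ, k₁ < −(d+1), and let σ be as in the previous statement (a (1,ρ)-symbol of order (k₀,k₁) supported in {ε ≤ y₁/y ≤ 1/ε}), with T₁σ(x,ξ,h) := (2πh)^{-(d+1)} ∫_{ℍ^{d+1}} ( ∫_{ℝ^{d+1}} e^{(i/h)⟨x₁−x, ξ₁−ξ⟩} σ(x,ξ;x₁,ξ₁) dξ₁ ) dx₁. Then for every n ≥ 0 there is a constant C_n (depending on finitely many symbol constants and on d, ε, ρ, k₀, k₁, n) such that for all h ∈ (0,1] and all (x,ξ): | T₁σ(x,ξ,h) − Σ_{s=0}^{n} ((ih)^s / s!) (∇_{x₁}·∇_{ξ₁})^s σ(x,ξ;x₁,ξ₁) |_{(x₁,ξ₁)=(x,ξ)} | ≤ C_n h^{(n+1)(1−2ρ)} (1 + y|ξ|)^{k₀+k₁}, where ∇_{x₁}·∇_{ξ₁} = ∂_{y₁}∂_{Y₁} + Σ_{i=1}^d ∂_{θ₁,i}∂_{J₁,i}.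 -/
open MeasureTheory Real Filter
open scoped RealInnerProductSpace ENNReal NNReal Topology

noncomputable section

/-- Euclidean `d`-space `ℝᵈ`. -/
abbrev Ed (d : ℕ) := EuclideanSpace ℝ (Fin d)

/-- The Euclidean norm of a covector `ξ = (Y, J) ∈ ℝ × ℝᵈ`. -/
def xiNorm (d : ℕ) (ξ : ℝ × Ed d) : ℝ := Real.sqrt (ξ.1 ^ 2 + ‖ξ.2‖ ^ 2)

/-- The Euclidean pairing `⟨x, ξ⟩` on `ℝ^{1+d} = ℝ × ℝᵈ`. -/
def epair (d : ℕ) (x ξ : ℝ × Ed d) : ℝ := x.1 * ξ.1 + ⟪x.2, ξ.2⟫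

/-- The half-cylinder `(0,∞) × D`, where `D ⊆ ℝᵈ` is a fundamental domain for the
lattice `Λ`: a concrete model for the full cusp `Z_Λ`. -/
def cusp (d : ℕ) (D : Set (Ed d)) : Set (ℝ × Ed d) := Set.Ioi (0 : ℝ) ×ˢ D

/-- The density `y^{-(d+1)}` of the Riemannian volume of `Z_Λ` with respect to the
Lebesgue measure `dy dθ` of the half-cylinder. -/
def cuspWeight (d : ℕ) (x : ℝ × Ed d) : ℝ≥0∞ := ENNReal.ofReal (x.1 ^ (-((d : ℝ) + 1)))

set_option synthInstance.maxHeartbeats 1000000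
set_option maxHeartbeats 1000000

/-- The twisted oscillatory transform
`T₁σ(x,ξ,h) = (2πh)^{-(d+1)} ∫_{x₁∈ℍ^{d+1}} ∫_{ξ₁∈ℝ^{d+1}}
e^{(i/h)⟨x₁-x,ξ₁-ξ⟩} σ(x,ξ;x₁,ξ₁) dξ₁ dx₁` (iterated integrals). -/
def T1 (d : ℕ) (h : ℝ)
    (σ : (ℝ × Ed d) → (ℝ × Ed d) → (ℝ × Ed d) → (ℝ × Ed d) → ℂ) (x ξ : ℝ × Ed d) : ℂ :=
  ((2 * π * h) ^ (d + 1))⁻¹ •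
    ∫ x₁ in Set.Ioi (0 : ℝ) ×ˢ (Set.univ : Set (Ed d)),
      ∫ ξ₁ : ℝ × Ed d,
        Complex.exp (Complex.I * Complex.ofReal (epair d (x₁ - x) (ξ₁ - ξ) / h)) * σ x ξ x₁ ξ₁

/-- The differential operator `∇_{x₁}·∇_{ξ₁} = ∂_{y₁}∂_{Y₁} + Σᵢ ∂_{θ₁,i}∂_{J₁,i}`
acting on functions of `(x₁, ξ₁)`. -/
def gradDot (d : ℕ) (g : (ℝ × Ed d) → (ℝ × Ed d) → ℂ) : (ℝ × Ed d) → (ℝ × Ed d) → ℂ :=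
  fun w z =>
    fderiv ℝ (fun w' : ℝ × Ed d => fderiv ℝ (g w') z ((1 : ℝ), (0 : Ed d))) w
        ((1 : ℝ), (0 : Ed d)) +
      ∑ i : Fin d,
        fderiv ℝ
          (fun w' : ℝ × Ed d =>
            fderiv ℝ (g w') z ((0 : ℝ), (EuclideanSpace.single i (1 : ℝ) : Ed d))) w
          ((0 : ℝ), (EuclideanSpace.single i (1 : ℝ) : Ed d))

open scoped ContDiff FourierTransform

section GenericDeriv
variable {F G : Type*} [NormedAddCommGroup F] [NormedSpace ℝ F]
  [NormedAddCommGroup G] [NormedSpace ℝ G] {κ : Type*}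

/-- Directional derivative. -/
def dd (v : F) (f : F → ℂ) : F → ℂ := fun x => fderiv ℝ f x v

/-- Iterated directional derivative, head of the list applied first. -/
def ddl (v : κ → F) : List κ → (F → ℂ) → (F → ℂ)
  | [], f => f
  | k :: l, f => ddl v l (dd (v k) f)

/-- Iteration of `f ↦ f - ∂f`. -/
def pl (v : κ → F) : List κ → (F → ℂ) → (F → ℂ)
  | [], f => f
  | k :: l, f => pl v l (f - dd (v k) f)

theorem dd_smooth {f : F → ℂ} (hf : ContDiff ℝ ∞ f) (v : F) : ContDiff ℝ ∞ (dd v f) :=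
  (hf.fderiv_right (m := ∞) (by simp)).clm_apply contDiff_const

theorem smooth_diff {f : F → ℂ} (hf : ContDiff ℝ ∞ f) : Differentiable ℝ f :=
  hf.differentiable (by simp)

theorem smooth_sub {f g : F → ℂ} (hf : ContDiff ℝ ∞ f) (hg : ContDiff ℝ ∞ g) :
    ContDiff ℝ ∞ (f - g) := hf.sub hg

theorem smooth_mul {f g : F → ℂ} (hf : ContDiff ℝ ∞ f) (hg : ContDiff ℝ ∞ g) :
    ContDiff ℝ ∞ (f * g) := hf.mul hg

theorem ddl_smooth (v : κ → F) (l : List κ) : ∀ {f : F → ℂ}, ContDiff ℝ ∞ f →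
    ContDiff ℝ ∞ (ddl v l f) := by
  induction l with
  | nil => intro f hf; exact hf
  | cons k l ih => intro f hf; exact ih (dd_smooth hf _)

theorem pl_smooth (v : κ → F) (l : List κ) : ∀ {f : F → ℂ}, ContDiff ℝ ∞ f →
    ContDiff ℝ ∞ (pl v l f) := by
  induction l with
  | nil => intro f hf; exact hf
  | cons k l ih => intro f hf; exact ih (smooth_sub hf (dd_smooth hf _))

theorem dd_add {f g : F → ℂ} (hf : ContDiff ℝ ∞ f) (hg : ContDiff ℝ ∞ g) (v : F) :
    dd v (f + g) = dd v f + dd v g := by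
  funext x
  simp only [dd, Pi.add_apply]
  rw [fderiv_add (smooth_diff hf x) (smooth_diff hg x)]; rfl

theorem dd_sub {f g : F → ℂ} (hf : ContDiff ℝ ∞ f) (hg : ContDiff ℝ ∞ g) (v : F) :
    dd v (f - g) = dd v f - dd v g := by
  funext x
  simp only [dd, Pi.sub_apply]
  rw [fderiv_sub (smooth_diff hf x) (smooth_diff hg x)]; rfl

theorem dd_smul {f : F → ℂ} (hf : ContDiff ℝ ∞ f) (c : ℂ) (v : F) :
    dd v (c • f) = c • dd v f := by
  funext x
  simp only [dd, Pi.smul_apply]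
  rw [fderiv_const_smul (smooth_diff hf x)]; rfl

theorem dd_mul {f g : F → ℂ} (hf : ContDiff ℝ ∞ f) (hg : ContDiff ℝ ∞ g) (v : F) :
    dd v (f * g) = dd v f * g + f * dd v g := by
  funext x
  simp only [dd, Pi.add_apply, Pi.mul_apply]
  rw [fderiv_mul (smooth_diff hf x) (smooth_diff hg x)]
  simp [mul_comm]; ring

theorem dd_comm {f : F → ℂ} (hf : ContDiff ℝ ∞ f) (u v : F) :
    dd u (dd v f) = dd v (dd u f) := by
  funext x
  have hd : DifferentiableAt ℝ (fderiv ℝ f) x :=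
    (hf.fderiv_right (m := ∞) (by simp)).differentiable (by simp) x
  have key : ∀ a b : F, dd a (dd b f) x = fderiv ℝ (fderiv ℝ f) x a b := by
    intro a b
    unfold dd
    rw [fderiv_clm_apply hd (differentiableAt_const b)]
    simp
  rw [key, key]
  exact (hf.contDiffAt.isSymmSndFDerivAt (by simp; exact WithTop.coe_le_coe.2 le_top)) u v

theorem dd_ddl_comm (v : κ → F) (l : List κ) (u : F) : ∀ {f : F → ℂ}, ContDiff ℝ ∞ f →
    dd u (ddl v l f) = ddl v l (dd u f) := by
  induction l with
  | nil => intro f hf; rfl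
  | cons k l ih => intro f hf; simp only [ddl]; rw [ih (dd_smooth hf _), dd_comm hf]

theorem dd_pl_comm (v : κ → F) (l : List κ) (u : F) : ∀ {f : F → ℂ}, ContDiff ℝ ∞ f →
    dd u (pl v l f) = pl v l (dd u f) := by
  induction l with
  | nil => intro f hf; rfl
  | cons k l ih =>
    intro f hf; simp only [pl]
    rw [ih (smooth_sub hf (dd_smooth hf _)), dd_sub hf (dd_smooth hf _), dd_comm hf]

theorem ddl_append (v : κ → F) (l l' : List κ) : ∀ (f : F → ℂ),
    ddl v (l ++ l') f = ddl v l' (ddl v l f) := by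
  induction l with
  | nil => intro f; rfl
  | cons k l ih => intro f; exact ih _

theorem ddl_map {κ' : Type*} (v : κ → F) (r : κ' → κ) (l : List κ') : ∀ (f : F → ℂ),
    ddl v (l.map r) f = ddl (v ∘ r) l f := by
  induction l with
  | nil => intro f; rfl
  | cons k l ih => intro f; exact ih _

theorem ddl_perm (v : κ → F) {l l' : List κ} (h : l.Perm l') : ∀ {f : F → ℂ}, ContDiff ℝ ∞ f →
    ddl v l f = ddl v l' f := by
  induction h with
  | nil => intro f hf; rfl
  | cons x _ ih => intro f hf; exact ih (dd_smooth hf _)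
  | swap x y l => intro f hf; simp only [ddl]; rw [dd_comm hf]
  | trans _ _ ih1 ih2 => intro f hf; rw [ih1 hf, ih2 hf]

theorem ddl_add (v : κ → F) (l : List κ) : ∀ {f g : F → ℂ}, ContDiff ℝ ∞ f → ContDiff ℝ ∞ g →
    ddl v l (f + g) = ddl v l f + ddl v l g := by
  induction l with
  | nil => intro f g hf hg; rfl
  | cons k l ih =>
    intro f g hf hg; simp only [ddl]; rw [dd_add hf hg, ih (dd_smooth hf _) (dd_smooth hg _)]

theorem ddl_smul (v : κ → F) (l : List κ) (c : ℂ) : ∀ {f : F → ℂ}, ContDiff ℝ ∞ f →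
    ddl v l (c • f) = c • ddl v l f := by
  induction l with
  | nil => intro f hf; rfl
  | cons k l ih =>
    intro f hf; simp only [ddl]; rw [dd_smul hf, ih (dd_smooth hf _)]

theorem dd_comp {f : G → ℂ} (hf : ContDiff ℝ ∞ f) {A : F → G} {A' : F →L[ℝ] G}
    (hA : ∀ x, HasFDerivAt A A' x) {u : F} {u' : G} {c : ℝ} (h : A' u = c • u') :
    dd u (f ∘ A) = (c : ℂ) • (dd u' f ∘ A) := by
  funext x
  simp only [dd]
  rw [((smooth_diff hf (A x)).hasFDerivAt.comp x (hA x)).fderiv]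
  simp [h, dd]

theorem ddl_comp {A : F → G} {A' : F →L[ℝ] G} (hAs : ContDiff ℝ ∞ A)
    (hA : ∀ x, HasFDerivAt A A' x) {v : κ → F} {v' : κ → G} {c : κ → ℝ}
    (h : ∀ k, A' (v k) = c k • v' k) (l : List κ) : ∀ {f : G → ℂ}, ContDiff ℝ ∞ f →
    ddl v l (f ∘ A) = (((l.map c).prod : ℝ) : ℂ) • (ddl v' l f ∘ A) := by
  induction l with
  | nil => intro f hf; simp [ddl]
  | cons k l ih =>
    intro f hf
    simp only [ddl]
    rw [dd_comp hf hA (h k), ddl_smul _ _ _ ((dd_smooth hf _).comp hAs), ih (dd_smooth hf _)]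
    rw [smul_smul]; simp

theorem pl_comp {A : F → G} {A' : F →L[ℝ] G}
    (hA : ∀ x, HasFDerivAt A A' x) {v : κ → F} {v' : κ → G}
    (h : ∀ k, A' (v k) = v' k) (l : List κ) : ∀ {f : G → ℂ}, ContDiff ℝ ∞ f →
    pl v l (f ∘ A) = (pl v' l f ∘ A) := by
  induction l with
  | nil => intro f hf; simp [pl]
  | cons k l ih =>
    intro f hf
    simp only [pl]
    have := dd_comp hf hA (u := v k) (u' := v' k) (c := 1) (by simp [h])
    rw [this, ← ih (smooth_sub hf (dd_smooth hf _))]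
    congr 1
    funext x; simp

/-- Uniform symbol families with weight `W`. -/
structure SymC {ι : Type*} (v : κ → F) (W : ι → F → ℝ) (b : ι → F → ℂ) : Prop where
  smooth : ∀ p, ContDiff ℝ ∞ (b p)
  bd : ∀ l : List κ, ∃ C : ℝ, 0 ≤ C ∧ ∀ p x, ‖ddl v l (b p) x‖ ≤ C * W p x

variable {ι : Type*} {v : κ → F} {W W' : ι → F → ℝ} {b b' : ι → F → ℂ}

theorem SymC.dd (h : SymC v W b) (k : κ) : SymC v W (fun p => dd (v k) (b p)) :=
  ⟨fun p => dd_smooth (h.smooth p) _, fun l => h.bd (k :: l)⟩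

theorem SymC.add (h : SymC v W b) (h' : SymC v W b') : SymC v W (fun p => b p + b' p) := by
  refine ⟨fun p => (h.smooth p).add (h'.smooth p), fun l => ?_⟩
  obtain ⟨C, hC, H⟩ := h.bd l
  obtain ⟨C', hC', H'⟩ := h'.bd l
  refine ⟨C + C', by positivity, fun p x => ?_⟩
  rw [ddl_add _ _ (h.smooth p) (h'.smooth p), add_mul]
  exact (norm_add_le _ _).trans (add_le_add (H p x) (H' p x))

theorem SymC.smul (h : SymC v W b) (c : ℂ) : SymC v W (fun p => c • b p) := by
  refine ⟨fun p => contDiff_const.smul (h.smooth p), fun l => ?_⟩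
  obtain ⟨C, hC, H⟩ := h.bd l
  refine ⟨‖c‖ * C, by positivity, fun p x => ?_⟩
  rw [ddl_smul _ _ _ (h.smooth p), mul_assoc]
  simp only [Pi.smul_apply, smul_eq_mul, norm_mul]
  exact mul_le_mul_of_nonneg_left (H p x) (norm_nonneg _)

theorem SymC.sub (h : SymC v W b) (h' : SymC v W b') : SymC v W (fun p => b p - b' p) := by
  have := h.add (h'.smul (-1))
  convert this using 2 with p
  simp [sub_eq_add_neg]

theorem ddl_zero (v : κ → F) (l : List κ) : ddl v l (0 : F → ℂ) = 0 := by
  induction l with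
  | nil => rfl
  | cons k l ih =>
    have : _root_.dd (v k) (0 : F → ℂ) = 0 := by
      funext x; simp [_root_.dd]
    simp only [ddl]; rw [this, ih]

theorem SymC.zero : SymC v W (fun _ => 0) := by
  refine ⟨fun p => contDiff_const, fun l => ⟨0, le_rfl, fun p x => ?_⟩⟩
  rw [ddl_zero]; simp

theorem SymC.sum {J : Type*} (s : Finset J) {b : J → ι → F → ℂ} (h : ∀ j, SymC v W (b j)) :
    SymC v W (fun p => ∑ j ∈ s, b j p) := by
  classical
  induction s using Finset.induction_on with
  | empty => simpa using SymC.zero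
  | insert j s hj ih => simpa [Finset.sum_insert hj] using (h j).add ih

theorem SymC.pl {κ' : Type*} {r : κ' → κ} (L : List κ') : ∀ {b : ι → F → ℂ}, SymC v W b →
    SymC v W (fun p => pl (fun k => v (r k)) L (b p)) := by
  induction L with
  | nil => intro b h; exact h
  | cons k l ih => intro b h; exact ih (h.sub (h.dd (r k)))

theorem SymC.mono (h : SymC v W b) (hW : ∃ C, 0 ≤ C ∧ ∀ p x, W p x ≤ C * W' p x) : SymC v W' b := by
  refine ⟨h.smooth, fun l => ?_⟩
  obtain ⟨C, hC, H⟩ := h.bd l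
  obtain ⟨C', hC', H'⟩ := hW
  refine ⟨C * C', by positivity, fun p x => (H p x).trans ?_⟩
  rw [mul_assoc]
  exact mul_le_mul_of_nonneg_left (H' p x) hC

theorem SymC.mul (h : SymC v W b) (h' : SymC v W' b') :
    SymC v (fun p x => W p x * W' p x) (fun p => b p * b' p) := by
  refine ⟨fun p => (h.smooth p).mul (h'.smooth p), fun l => ?_⟩
  induction l generalizing b b' with
  | nil =>
    obtain ⟨C, hC, H⟩ := h.bd []
    obtain ⟨C', hC', H'⟩ := h'.bd []
    refine ⟨C * C', by positivity, fun p x => ?_⟩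
    simp only [ddl, Pi.mul_apply, norm_mul] at *
    calc _ ≤ (C * W p x) * (C' * W' p x) :=
          mul_le_mul (H p x) (H' p x) (norm_nonneg _) ((norm_nonneg _).trans (H p x))
      _ = _ := by ring
  | cons k l ih =>
    obtain ⟨C, hC, H⟩ := ih (h.dd k) h'
    obtain ⟨C', hC', H'⟩ := ih h (h'.dd k)
    refine ⟨C + C', by positivity, fun p x => ?_⟩
    simp only [ddl]
    rw [dd_mul (h.smooth p) (h'.smooth p),
      ddl_add _ _ (smooth_mul (dd_smooth (h.smooth p) _) (h'.smooth p))
        (smooth_mul (h.smooth p) (dd_smooth (h'.smooth p) _)), add_mul]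
    exact (norm_add_le _ _).trans (add_le_add (H p x) (H' p x))

end GenericDeriv


section FourierOne
variable {m : ℕ}

def ev (j : Fin m) : Ed m := EuclideanSpace.single j 1

def qf (j : Fin m) (w : Ed m) : ℂ := (1 + Complex.I * (w j : ℂ))⁻¹

def qL (L : List (Fin m)) (w : Ed m) : ℂ := (L.map (fun j => qf j w)).prod

def fI (w : Ed m) (φ : Ed m → ℂ) : ℂ :=
  ∫ z : Ed m, Complex.exp (Complex.I * ((⟪w, z⟫ : ℝ) : ℂ)) * φ z

theorem one_add_I_ne (t : ℝ) : (1 + Complex.I * (t : ℂ)) ≠ 0 := by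
  intro h
  have := congrArg Complex.re h
  simp at this

theorem norm_exp_I (t : ℝ) : ‖Complex.exp (Complex.I * (t : ℂ))‖ = 1 := by
  rw [mul_comm]; exact Complex.norm_exp_ofReal_mul_I t

theorem integrable_exp_mul {φ : Ed m → ℂ} (hφ : Integrable φ) (w : Ed m) :
    Integrable (fun z : Ed m => Complex.exp (Complex.I * ((⟪w, z⟫ : ℝ) : ℂ)) * φ z) := by
  refine hφ.bdd_mul (c := 1) ?_ ?_
  · exact Continuous.aestronglyMeasurable (by fun_prop)
  · exact Eventually.of_forall fun z => (norm_exp_I _).le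

theorem hasFDerivAt_phase (w z : Ed m) :
    HasFDerivAt (fun z : Ed m => Complex.exp (Complex.I * ((⟪w, z⟫ : ℝ) : ℂ)))
      ((Complex.exp (Complex.I * ((⟪w, z⟫ : ℝ) : ℂ))) •
        (Complex.I • (Complex.ofRealCLM.comp (innerSL ℝ w)))) z := by
  have h1 : HasFDerivAt (fun z : Ed m => Complex.I * ((⟪w, z⟫ : ℝ) : ℂ))
      (Complex.I • (Complex.ofRealCLM.comp (innerSL ℝ w))) z := by
    have := (Complex.ofRealCLM.comp (innerSL ℝ w)).hasFDerivAt (x := z)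
    exact this.const_mul Complex.I
  exact h1.cexp

theorem fI_dd {φ : Ed m → ℂ} (hs : ContDiff ℝ ∞ φ) (j : Fin m) (hφ : Integrable φ)
    (hφ' : Integrable (dd (ev j) φ)) (w : Ed m) :
    fI w (dd (ev j) φ) = -(Complex.I * (w j : ℂ)) * fI w φ := by
  have hd : ∀ z, fderiv ℝ (fun z : Ed m => Complex.exp (Complex.I * ((⟪w, z⟫ : ℝ) : ℂ))) z (ev j)
      = (Complex.I * (w j : ℂ)) * Complex.exp (Complex.I * ((⟪w, z⟫ : ℝ) : ℂ)) := by
    intro z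
    rw [(hasFDerivAt_phase w z).fderiv]
    have h0 : (⟪w, ev j⟫ : ℝ) = w j := by
      simp [ev, EuclideanSpace.inner_single_right]
    simp [h0, mul_comm]
  have := integral_mul_fderiv_eq_neg_fderiv_mul_of_integrable (μ := (volume : Measure (Ed m)))
    (f := fun z : Ed m => Complex.exp (Complex.I * ((⟪w, z⟫ : ℝ) : ℂ))) (g := φ) (v := ev j)
    (by
      simp_rw [hd]
      have := (integrable_exp_mul hφ w).const_mul (Complex.I * (w j : ℂ))
      simpa only [mul_assoc] using this)
    (integrable_exp_mul hφ' w) (integrable_exp_mul hφ w)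
    (fun z _ => (hasFDerivAt_phase w z).differentiableAt) (fun z _ => smooth_diff hs z)
  unfold fI
  rw [show (∫ z : Ed m, Complex.exp (Complex.I * ((⟪w, z⟫ : ℝ) : ℂ)) * dd (ev j) φ z) = _ from this]
  simp_rw [hd, mul_assoc]
  rw [integral_const_mul, integral_const_mul]
  ring

theorem ddl_sub {F κ : Type*} [NormedAddCommGroup F] [NormedSpace ℝ F] (v : κ → F) (l : List κ) {f g : F → ℂ} (hf : ContDiff ℝ ∞ f) (hg : ContDiff ℝ ∞ g) :
    ddl v l (f - g) = ddl v l f - ddl v l g := by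
  have h1 : f - g = f + (-1 : ℂ) • g := by simp [sub_eq_add_neg]
  have hg' : ContDiff ℝ ∞ ((-1 : ℂ) • g) := contDiff_const.smul hg
  rw [h1, ddl_add v l hf hg', ddl_smul v l _ hg]; simp [sub_eq_add_neg]

theorem fI_pl (L : List (Fin m)) (w : Ed m) : ∀ {φ : Ed m → ℂ}, ContDiff ℝ ∞ φ →
    (∀ l, Integrable (ddl ev l φ)) → fI w φ = qL L w * fI w (pl ev L φ) := by
  induction L with
  | nil => intro φ hs hi; simp [qL, pl]
  | cons j L ih =>
    intro φ hs hi
    have hs' := smooth_sub hs (dd_smooth hs (ev j))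
    have h1 := ih hs' (fun l => by
      rw [ddl_sub _ _ hs (dd_smooth hs _)]
      exact (hi l).sub (hi (j :: l)))
    have h2 : fI w (φ - dd (ev j) φ) = (1 + Complex.I * (w j : ℂ)) * fI w φ := by
      have : fI w (φ - dd (ev j) φ) = fI w φ - fI w (dd (ev j) φ) := by
        unfold fI
        have := integral_sub (integrable_exp_mul (hi []) w) (integrable_exp_mul (hi [j]) w)
        simp only [ddl] at this
        rw [← this]
        simp [mul_sub]
      rw [this, fI_dd hs j (hi []) (hi [j])]; ring
    have h3 : fI w φ = qf j w * fI w (φ - dd (ev j) φ) := by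
      rw [h2, qf, inv_mul_cancel_left₀ (one_add_I_ne _)]
    rw [h3, h1]
    simp [qL, pl, mul_assoc]

def Bw (w : Ed m) : ℝ := (1 + ‖w‖ ^ 2)⁻¹

def LN (m N : ℕ) : List (Fin m) := (List.replicate (2 * N) (List.finRange m)).flatten

theorem Bw_pos (w : Ed m) : 0 < Bw w := by unfold Bw; positivity

theorem Bw_le_one (w : Ed m) : Bw w ≤ 1 := by
  unfold Bw; exact inv_le_one_of_one_le₀ (by nlinarith [sq_nonneg ‖w‖])

theorem qL_LN (N : ℕ) (w : Ed m) : qL (LN m N) w = (∏ j, qf j w) ^ (2 * N) := by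
  have : ∀ k : ℕ, qL (List.replicate k (List.finRange m)).flatten w = (∏ j, qf j w) ^ k := by
    intro k
    induction k with
    | zero => simp [qL]
    | succ k ih =>
      simp only [qL] at ih ⊢
      simp only [List.replicate_succ, List.flatten_cons, List.map_append, List.prod_append, ih]
      rw [pow_succ', ← List.ofFn_eq_map, List.prod_ofFn]
  exact this _

theorem one_add_sum_le_prod' {κ : Type*} (s : Finset κ) (f : κ → ℝ) (hf : ∀ i, 0 ≤ f i) :
    1 + ∑ i ∈ s, f i ≤ ∏ i ∈ s, (1 + f i) := by
  classical
  induction s using Finset.induction_on with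
  | empty => simp
  | insert j s hj ih =>
    rw [Finset.sum_insert hj, Finset.prod_insert hj]
    have : 0 ≤ ∑ i ∈ s, f i := Finset.sum_nonneg fun i _ => hf i
    nlinarith [hf j, mul_nonneg (hf j) this]

theorem norm_qf_sq (j : Fin m) (w : Ed m) : ‖qf j w‖ ^ 2 = (1 + (w j) ^ 2)⁻¹ := by
  unfold qf
  rw [norm_inv, inv_pow, Complex.sq_norm, Complex.normSq_apply]
  simp [sq]

theorem norm_qL_le (N : ℕ) (w : Ed m) : ‖qL (LN m N) w‖ ≤ Bw w ^ N := by
  rw [qL_LN, norm_pow, pow_mul]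
  refine pow_le_pow_left₀ (by positivity) ?_ N
  rw [norm_prod, ← Finset.prod_pow]
  simp_rw [norm_qf_sq]
  rw [Finset.prod_inv_distrib, Bw]
  refine inv_anti₀ (by positivity) ?_
  rw [EuclideanSpace.norm_sq_eq]
  simp only [Real.norm_eq_abs, sq_abs]
  exact one_add_sum_le_prod' _ _ fun i => sq_nonneg _

theorem integrable_Bw {N : ℕ} (h : m < 2 * N) : Integrable (fun w : Ed m => Bw w ^ N) := by
  have := integrable_rpow_neg_one_add_norm_sq (E := Ed m) (μ := volume) (r := 2 * N)
    (by simp; exact_mod_cast h)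
  refine this.congr (Eventually.of_forall fun w => ?_)
  simp only [Bw]
  rw [show (-(2 * (N : ℝ)) / 2) = -(N : ℝ) by ring, Real.rpow_neg (by positivity), Real.rpow_natCast,
    inv_pow]

theorem abs_coord_le (w : Ed m) (j : Fin m) : ‖(w j : ℂ)‖ * Bw w ≤ 1 := by
  unfold Bw
  rw [← div_eq_mul_inv, div_le_one (by positivity)]
  have : ‖w j‖ ≤ ‖w‖ := PiLp.norm_apply_le w j
  simp only [Complex.norm_real]
  nlinarith [sq_nonneg (‖w‖ - 1)]

theorem Bw_cont : Continuous (Bw : Ed m → ℝ) := by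
  unfold Bw
  exact Continuous.inv₀ (by fun_prop) fun w => by positivity

theorem qf_smooth (j : Fin m) : ContDiff ℝ ∞ (qf j : Ed m → ℂ) := by
  unfold qf
  refine ContDiff.inv ?_ fun w => one_add_I_ne _
  have h : ContDiff ℝ ∞ (fun w : Ed m => ((w j : ℝ) : ℂ)) :=
    (Complex.ofRealCLM.comp (EuclideanSpace.proj j)).contDiff
  exact contDiff_const.add (contDiff_const.mul h)

theorem qL_smooth (L : List (Fin m)) : ContDiff ℝ ∞ (qL L : Ed m → ℂ) := by
  induction L with
  | nil =>
    have : (qL [] : Ed m → ℂ) = fun _ => 1 := by funext w; simp [qL]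
    rw [this]; exact contDiff_const
  | cons j L ih =>
    have : (qL (j :: L) : Ed m → ℂ) = qf j * qL L := by funext w; simp [qL]
    rw [this]; exact (qf_smooth j).mul ih

/-- `qL` is a symbol with weight its own modulus. -/
theorem dd_qf_pow (i j : Fin m) (k : ℕ) :
    dd (ev i) ((qf j) ^ (k + 1)) =
      ((if i = j then (-(Complex.I) * (k + 1 : ℂ)) else 0) : ℂ) • ((qf j) ^ (k + 2) : Ed m → ℂ) := by
  funext w
  have h : HasFDerivAt (fun w : Ed m => (1 + Complex.I * ((w j : ℝ) : ℂ)))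
      (Complex.I • (Complex.ofRealCLM.comp (EuclideanSpace.proj j))) w := by
    have := (Complex.ofRealCLM.comp (EuclideanSpace.proj (𝕜 := ℝ) j)).hasFDerivAt (x := w)
    exact (this.const_mul Complex.I).const_add 1
  have h2 := (((hasDerivAt_inv (one_add_I_ne (w j))).fun_pow (k + 1)).hasFDerivAt.restrictScalars ℝ).comp w h
  have h3 : ((qf j) ^ (k + 1) : Ed m → ℂ) = fun w => ((1 + Complex.I * ((w j : ℝ) : ℂ))⁻¹) ^ (k + 1) := by
    funext w; simp [qf]
  rw [h3]
  unfold dd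
  erw [HasFDerivAt.fderiv h2]
  have hne := one_add_I_ne (w j)
  by_cases hij : i = j
  · subst hij
    simp [ev, qf]
    field_simp
    ring
  · have : j ≠ i := fun h => hij h.symm
    simp [ev, qf, hij, this]

end FourierOne


section TwoVar
variable {m : ℕ} {ι : Type*}

theorem SymC.comp {F G κ : Type*} [NormedAddCommGroup F] [NormedSpace ℝ F]
    [NormedAddCommGroup G] [NormedSpace ℝ G] {ι' : Type*}
    {v : κ → F} {v' : κ → G} {W : ι → G → ℝ} {b : ι → G → ℂ} (h : SymC v' W b)
    (r : ι' → ι) (A : ι' → F → G) (A' : ι' → F →L[ℝ] G) (hAs : ∀ p, ContDiff ℝ ∞ (A p))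
    (hA : ∀ p x, HasFDerivAt (A p) (A' p) x) (c : ι' → κ → ℝ)
    (hc : ∀ p k, A' p (v k) = c p k • v' k) (R : ℝ) (hR : ∀ p k, |c p k| ≤ R) :
    SymC v (fun p x => W (r p) (A p x)) (fun p => b (r p) ∘ A p) := by
  refine ⟨fun p => (h.smooth _).comp (hAs p), fun l => ?_⟩
  obtain ⟨C, hC, H⟩ := h.bd l
  refine ⟨|R| ^ l.length * C, by positivity, fun p x => ?_⟩
  rw [ddl_comp (hAs p) (hA p) (hc p) l (h.smooth _)]
  simp only [Pi.smul_apply, Function.comp_apply, smul_eq_mul, norm_mul, Complex.norm_real]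
  rw [mul_assoc]
  refine mul_le_mul ?_ (H _ _) (norm_nonneg _) (by positivity)
  clear H
  induction l with
  | nil => simp
  | cons k l ih =>
    simp only [List.map_cons, List.prod_cons, norm_mul, List.length_cons, pow_succ']
    exact mul_le_mul ((hR p k).trans (le_abs_self R)) ih (norm_nonneg _) (abs_nonneg _)

def dv : Fin m ⊕ Fin m → Ed m × Ed m := Sum.elim (fun j => (ev j, 0)) (fun j => (0, ev j))

@[simp] theorem dv_inl (j : Fin m) : dv (Sum.inl j) = (ev j, (0 : Ed m)) := rfl
@[simp] theorem dv_inr (j : Fin m) : dv (Sum.inr j) = ((0 : Ed m), ev j) := rfl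

theorem symC_qf (j : Fin m) : SymC (ev : Fin m → Ed m) (fun (_ : Unit) w => ‖qf j w‖)
    (fun _ => qf j) := by
  refine ⟨fun _ => qf_smooth j, fun l => ?_⟩
  have key : ∀ k : ℕ, ∃ C : ℝ, 0 ≤ C ∧ ∀ w : Ed m, ‖ddl ev l (qf j ^ (k + 1)) w‖ ≤ C * ‖qf j w‖ := by
    induction l with
    | nil =>
      intro k
      refine ⟨1, zero_le_one, fun w => ?_⟩
      simp only [ddl, Pi.pow_apply, norm_pow, one_mul]
      have : ‖qf j w‖ ≤ 1 := by
        have h1 := norm_qf_sq j w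
        have h2 : (1 + (w j) ^ 2)⁻¹ ≤ 1 := inv_le_one_of_one_le₀ (by nlinarith [sq_nonneg (w j)])
        nlinarith [norm_nonneg (qf j w)]
      rw [pow_succ]
      exact mul_le_of_le_one_left (norm_nonneg _) (pow_le_one₀ (norm_nonneg _) this)
    | cons i l ih =>
      intro k
      obtain ⟨C, hC, H⟩ := ih (k + 1)
      simp only [ddl]
      rw [dd_qf_pow, ddl_smul _ _ _ (show ContDiff ℝ ∞ (qf j ^ (k + 2)) from (qf_smooth j).pow _)]
      refine ⟨‖((if i = j then (-(Complex.I) * (k + 1 : ℂ)) else 0) : ℂ)‖ * C, by positivity, fun w => ?_⟩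
      rw [Pi.smul_apply, norm_smul, mul_assoc]
      exact mul_le_mul_of_nonneg_left (H w) (norm_nonneg _)
  obtain ⟨C, hC, H⟩ := key 0
  exact ⟨C, hC, fun _ w => by simpa using H w⟩

theorem symC_one {F κ : Type*} [NormedAddCommGroup F] [NormedSpace ℝ F] (v : κ → F) :
    SymC v (fun (_ : Unit) _ => 1) (fun _ => (1 : F → ℂ)) := by
  refine ⟨fun _ => contDiff_const, fun l => ⟨1, zero_le_one, fun _ w => ?_⟩⟩
  cases l with
  | nil => simp [ddl]
  | cons k l =>
    have : dd (v k) (1 : F → ℂ) = 0 := by funext x; simp [dd]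
    simp only [ddl]; rw [this, ddl_zero]; simp

theorem symC_qL (L : List (Fin m)) : SymC (ev : Fin m → Ed m) (fun (_ : Unit) w => ‖qL L w‖)
    (fun _ => qL L) := by
  induction L with
  | nil =>
    convert symC_one (ev : Fin m → Ed m) using 1
    · funext _ w; simp [qL]
    · funext _ w; simp [qL]
  | cons j L ih =>
    convert (symC_qf j).mul ih using 1
    · funext _ w; simp [qL]
    · funext _ w; simp [qL]

theorem symC_qL_fst (L : List (Fin m)) : SymC (dv : _ → Ed m × Ed m)
    (fun (_ : ι) x => ‖qL L x.1‖) (fun _ x => qL L x.1) := by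
  have h1 : SymC (fun k : Fin m ⊕ Fin m => (ev (Sum.elim id id k) : Ed m))
      (fun (_ : Unit) w => ‖qL L w‖) (fun _ => qL L) := by
    refine ⟨(symC_qL L).smooth, fun l => ?_⟩
    obtain ⟨C, hC, H⟩ := (symC_qL L).bd (l.map (Sum.elim id id))
    refine ⟨C, hC, ?_⟩
    rw [ddl_map] at H
    exact H
  exact h1.comp (ι' := ι) (fun _ => ()) (fun _ => Prod.fst)
    (fun _ => ContinuousLinearMap.fst ℝ (Ed m) (Ed m)) (fun _ => contDiff_fst)
    (fun _ x => hasFDerivAt_fst) (fun _ => Sum.elim (fun _ => 1) (fun _ => 0))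
    (by rintro _ (k | k) <;> simp) 1 (by rintro _ (k | k) <;> simp)

variable {M : ι → Ed m → ℝ} {b : ι → Ed m × Ed m → ℂ}

def pz (L : List (Fin m)) (f : Ed m × Ed m → ℂ) : Ed m × Ed m → ℂ :=
  pl (fun j => dv (Sum.inr j)) L f

def pw (L : List (Fin m)) (f : Ed m × Ed m → ℂ) : Ed m × Ed m → ℂ :=
  pl (fun j => dv (Sum.inl j)) L f

theorem hasFDerivAt_mk_right (w z : Ed m) : HasFDerivAt (fun z : Ed m => (w, z))
    (ContinuousLinearMap.inr ℝ (Ed m) (Ed m)) z := hasFDerivAt_prodMk_right w z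

theorem hasFDerivAt_mk_left (w z : Ed m) : HasFDerivAt (fun w : Ed m => (w, z))
    (ContinuousLinearMap.inl ℝ (Ed m) (Ed m)) w := hasFDerivAt_prodMk_left w z

theorem ddl_slice_z {f : Ed m × Ed m → ℂ} (hf : ContDiff ℝ ∞ f) (w : Ed m) (l : List (Fin m)) :
    ddl ev l (fun z => f (w, z)) = fun z => ddl dv (l.map Sum.inr) f (w, z) := by
  have := ddl_comp (A := fun z : Ed m => (w, z)) (by fun_prop) (hasFDerivAt_mk_right w)
    (v := ev) (v' := dv ∘ Sum.inr) (c := fun _ => 1) (by intro k; simp) l hf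
  rw [ddl_map]
  simpa [Function.comp_def] using this

theorem ddl_slice_w {f : Ed m × Ed m → ℂ} (hf : ContDiff ℝ ∞ f) (z : Ed m) (l : List (Fin m)) :
    ddl ev l (fun w => f (w, z)) = fun w => ddl dv (l.map Sum.inl) f (w, z) := by
  have := ddl_comp (A := fun w : Ed m => (w, z)) (by fun_prop) (fun w => hasFDerivAt_mk_left w z)
    (v := ev) (v' := dv ∘ Sum.inl) (c := fun _ => 1) (by intro k; simp) l hf
  rw [ddl_map]
  simpa [Function.comp_def] using this

theorem pl_slice_z {f : Ed m × Ed m → ℂ} (hf : ContDiff ℝ ∞ f) (w : Ed m) (l : List (Fin m)) :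
    pl ev l (fun z => f (w, z)) = fun z => pz l f (w, z) :=
  pl_comp (A := fun z : Ed m => (w, z)) (hasFDerivAt_mk_right w)
    (v := ev) (v' := fun j => dv (Sum.inr j)) (by intro k; simp) l hf

theorem pl_slice_w {f : Ed m × Ed m → ℂ} (hf : ContDiff ℝ ∞ f) (z : Ed m) (l : List (Fin m)) :
    pl ev l (fun w => f (w, z)) = fun w => pw l f (w, z) :=
  pl_comp (A := fun w : Ed m => (w, z)) (fun w => hasFDerivAt_mk_left w z)
    (v := ev) (v' := fun j => dv (Sum.inl j)) (by intro k; simp) l hf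

theorem SymC.int_z (h : SymC dv (fun p x => M p x.2) b) (hM : ∀ p, Integrable (M p)) (p : ι)
    (w : Ed m) : Integrable (fun z => b p (w, z)) := by
  obtain ⟨C, hC, H⟩ := h.bd []
  refine ((hM p).const_mul C).mono' ?_ (Eventually.of_forall fun z => H p (w, z))
  exact ((h.smooth p).continuous.comp (by fun_prop)).aestronglyMeasurable

theorem SymC.ddl {F κ : Type*} [NormedAddCommGroup F] [NormedSpace ℝ F] {v : κ → F}
    {W : ι → F → ℝ} (l : List κ) {b : ι → F → ℂ} (h : SymC v W b) :
    SymC v W (fun p => ddl v l (b p)) :=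
  ⟨fun p => ddl_smooth _ _ (h.smooth p), fun l' => by
    simpa [ddl_append] using h.bd (l ++ l')⟩

theorem SymC.pz {W : ι → Ed m × Ed m → ℝ} (h : SymC dv W b) (L : List (Fin m)) :
    SymC dv W (fun p => pz L (b p)) := SymC.pl (r := Sum.inr) L h

theorem SymC.pw {W : ι → Ed m × Ed m → ℝ} (h : SymC dv W b) (L : List (Fin m)) :
    SymC dv W (fun p => pw L (b p)) := SymC.pl (r := Sum.inl) L h

theorem SymC.fI_eq (h : SymC dv (fun p x => M p x.2) b) (hM : ∀ p, Integrable (M p)) (p : ι)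
    (L : List (Fin m)) (w : Ed m) :
    fI w (fun z => b p (w, z)) = qL L w * fI w (fun z => _root_.pz L (b p) (w, z)) := by
  rw [fI_pl L w (φ := fun z => b p (w, z)) ((h.smooth p).comp (by fun_prop)), pl_slice_z (h.smooth p)]
  intro l
  rw [ddl_slice_z (h.smooth p)]
  exact (h.ddl _).int_z hM p w

def II (f : Ed m × Ed m → ℂ) : ℂ := ∫ w, fI w (fun z => f (w, z))

def osk (N : ℕ) (f : Ed m × Ed m → ℂ) (x : Ed m × Ed m) : ℂ :=
  qL (LN m N) x.1 * (Complex.exp (Complex.I * ((⟪x.1, x.2⟫ : ℝ) : ℂ)) * pz (LN m N) f x)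

theorem ker_cont {f : Ed m × Ed m → ℂ} (hf : ContDiff ℝ ∞ f) (N : ℕ) : Continuous (osk N f) := by
  unfold osk
  refine ((qL_smooth _).continuous.comp continuous_fst).mul (Continuous.mul ?_ ?_)
  · fun_prop
  · exact (pl_smooth _ _ hf).continuous

theorem SymC.ker_bd (h : SymC dv (fun p x => M p x.2) b) (N : ℕ) : ∃ C : ℝ, 0 ≤ C ∧
    ∀ p x, ‖osk N (b p) x‖ ≤ C * (Bw x.1 ^ N * M p x.2) := by
  obtain ⟨C, hC, H⟩ := (h.pz (LN m N)).bd []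
  refine ⟨C, hC, fun p x => ?_⟩
  simp only [osk, norm_mul, norm_exp_I, one_mul]
  calc _ ≤ Bw x.1 ^ N * (C * M p x.2) :=
        mul_le_mul (norm_qL_le N _) (H p x) (norm_nonneg _) (pow_nonneg (Bw_pos _).le _)
    _ = _ := by ring

theorem int_prod_weight {N : ℕ} (hN : m < 2 * N) {M : Ed m → ℝ} (hM : Integrable M) :
    Integrable (fun x : Ed m × Ed m => Bw x.1 ^ N * M x.2) := by
  rw [Measure.volume_eq_prod]
  exact (integrable_Bw hN).mul_prod hM

theorem SymC.ker_int (h : SymC dv (fun p x => M p x.2) b) (hM : ∀ p, Integrable (M p)) {N : ℕ}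
    (hN : m < 2 * N) (p : ι) : Integrable (osk N (b p)) := by
  obtain ⟨C, hC, H⟩ := h.ker_bd N
  exact ((int_prod_weight hN (hM p)).const_mul C).mono' (ker_cont (h.smooth p) N).aestronglyMeasurable
    (Eventually.of_forall fun x => H p x)

theorem SymC.fI_ker (h : SymC dv (fun p x => M p x.2) b) (hM : ∀ p, Integrable (M p)) (N : ℕ)
    (p : ι) (w : Ed m) : fI w (fun z => b p (w, z)) = ∫ z, osk N (b p) (w, z) := by
  rw [h.fI_eq hM p (LN m N) w, fI, ← integral_const_mul]; rfl

theorem SymC.fI_int (h : SymC dv (fun p x => M p x.2) b) (hM : ∀ p, Integrable (M p)) (p : ι) :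
    Integrable (fun w => fI w (fun z => b p (w, z))) := by
  have := h.ker_int hM (N := m + 1) (by omega) p
  rw [Measure.volume_eq_prod] at this
  simp_rw [h.fI_ker hM (m + 1) p]
  exact this.integral_prod_left

theorem SymC.II_eq (h : SymC dv (fun p x => M p x.2) b) (hM : ∀ p, Integrable (M p)) {N : ℕ}
    (hN : m < 2 * N) (p : ι) : II (b p) = ∫ x, osk N (b p) x := by
  have := h.ker_int hM hN p
  rw [Measure.volume_eq_prod] at this ⊢
  rw [integral_prod _ this, II]
  simp_rw [h.fI_ker hM N p]

theorem SymC.II_sum {J : Type*} (s : Finset J) {b : J → ι → Ed m × Ed m → ℂ}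
    (h : ∀ j, SymC dv (fun p x => M p x.2) (b j)) (hM : ∀ p, Integrable (M p)) (p : ι) :
    II (∑ j ∈ s, b j p) = ∑ j ∈ s, II (b j p) := by
  unfold II
  rw [← integral_finsetSum _ fun j _ => (h j).fI_int hM p]
  congr 1; funext w
  unfold fI
  rw [← integral_finsetSum _ fun j _ => integrable_exp_mul ((h j).int_z hM p w) w]
  congr 1; funext z
  simp [Finset.mul_sum]

theorem SymC.coord_ker (h : SymC dv (fun p x => M p x.2) b) (hM : ∀ p, Integrable (M p)) {N : ℕ}
    (hN : m < 2 * N) (p : ι) (j : Fin m) :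
    Integrable (fun x : Ed m × Ed m => (x.1 j : ℂ) * osk (N + 1) (b p) x) ∧
    ∫ x : Ed m × Ed m, (x.1 j : ℂ) * osk (N + 1) (b p) x =
      Complex.I * II (_root_.dd (dv (Sum.inr j)) (b p)) := by
  have hi : Integrable (fun x : Ed m × Ed m => (x.1 j : ℂ) * osk (N + 1) (b p) x) := by
    obtain ⟨C, hC, H⟩ := h.ker_bd (N + 1)
    refine ((int_prod_weight hN (hM p)).const_mul C).mono' ?_ (Eventually.of_forall fun x => ?_)
    · refine (Continuous.mul ?_ (ker_cont (h.smooth p) _)).aestronglyMeasurable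
      fun_prop
    · rw [norm_mul]
      have h0 : 0 ≤ C * (Bw x.1 ^ N * M p x.2) := by
        have h1 := (norm_nonneg _).trans (H p x)
        have h2 := Bw_pos x.1
        rw [pow_succ, show C * (Bw x.1 ^ N * Bw x.1 * M p x.2) =
          Bw x.1 * (C * (Bw x.1 ^ N * M p x.2)) by ring] at h1
        exact nonneg_of_mul_nonneg_right h1 h2
      calc _ ≤ ‖(x.1 j : ℂ)‖ * (C * (Bw x.1 ^ (N + 1) * M p x.2)) :=
            mul_le_mul_of_nonneg_left (H p x) (norm_nonneg _)
        _ = (‖(x.1 j : ℂ)‖ * Bw x.1) * (C * (Bw x.1 ^ N * M p x.2)) := by ring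
        _ ≤ 1 * (C * (Bw x.1 ^ N * M p x.2)) :=
            mul_le_mul_of_nonneg_right (abs_coord_le _ _) h0
        _ = _ := one_mul _
  refine ⟨hi, ?_⟩
  rw [Measure.volume_eq_prod] at hi ⊢
  rw [integral_prod _ hi, II, ← integral_const_mul]
  congr 1; funext w
  simp only
  rw [integral_const_mul, ← h.fI_ker hM (N + 1) p]
  have e1 : (fun z => _root_.dd (dv (Sum.inr j)) (b p) (w, z)) =
      _root_.dd (ev j) (fun z => b p (w, z)) := by
    have := ddl_slice_z (h.smooth p) w [j]
    exact this.symm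
  rw [e1, fI_dd (φ := fun z => b p (w, z)) ((h.smooth p).comp (by fun_prop)) j (h.int_z hM p w)
    (by rw [← e1]; exact (h.dd (Sum.inr j)).int_z hM p w)]
  ring_nf
  simp

end TwoVar


section Expansion
variable {m : ℕ} {ι : Type*} {M : ι → Ed m → ℝ} {b : ι → Ed m × Ed m → ℂ}

def scA (t : ℝ) (x : Ed m × Ed m) : Ed m × Ed m := (t • x.1, x.2)

def scA' (t : ℝ) : (Ed m × Ed m) →L[ℝ] (Ed m × Ed m) :=
  (t • ContinuousLinearMap.fst ℝ (Ed m) (Ed m)).prod (ContinuousLinearMap.snd ℝ (Ed m) (Ed m))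

theorem scA_deriv (t : ℝ) (x : Ed m × Ed m) : HasFDerivAt (scA t) (scA' (m := m) t) x :=
  (scA' t).hasFDerivAt

theorem scA_smooth (t : ℝ) : ContDiff ℝ ∞ (scA t : Ed m × Ed m → _) :=
  (scA' (m := m) t).contDiff

def sc (t : ℝ) (f : Ed m × Ed m → ℂ) : Ed m × Ed m → ℂ := f ∘ scA t

theorem pz_sc (t : ℝ) {f : Ed m × Ed m → ℂ} (hf : ContDiff ℝ ∞ f) (L : List (Fin m)) :
    pz L (sc t f) = sc t (pz L f) :=
  pl_comp (scA_deriv t) (by intro k; simp [scA']) L hf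

theorem dd_inr_sc (t : ℝ) {f : Ed m × Ed m → ℂ} (hf : ContDiff ℝ ∞ f) (j : Fin m) :
    dd (dv (Sum.inr j)) (sc t f) = sc t (dd (dv (Sum.inr j)) f) := by
  have := dd_comp hf (scA_deriv t) (u := dv (Sum.inr j)) (u' := dv (Sum.inr j)) (c := 1)
    (by simp [scA'])
  simpa [sc] using this

theorem SymC.sc (h : SymC dv (fun p x => M p x.2) b) (t : ℝ) :
    SymC dv (fun p x => M p x.2) (fun p => sc t (b p)) :=
  h.comp id (fun _ => scA t) (fun _ => scA' t) (fun _ => scA_smooth t) (fun _ => scA_deriv t)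
    (fun _ => Sum.elim (fun _ => t) (fun _ => 1)) (by rintro _ (k | k) <;> simp [scA']) (max |t| 1)
    (by rintro _ (k | k) <;> simp)

theorem SymC.sc01 (h : SymC dv (fun p x => M p x.2) b) :
    SymC dv (fun (q : ι × Set.Icc (0 : ℝ) 1) x => M q.1 x.2) (fun q => _root_.sc q.2 (b q.1)) :=
  SymC.comp (ι' := ι × Set.Icc (0 : ℝ) 1) (v := dv) h Prod.fst
    (fun q => scA (q.2 : ℝ)) (fun q => scA' (q.2 : ℝ)) (fun q => scA_smooth _)
    (fun q => scA_deriv _)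
    (fun q => Sum.elim (fun _ => (q.2 : ℝ)) (fun _ => 1)) (by rintro _ (k | k) <;> simp [scA']) 1
    (by
      rintro ⟨_, t, ht⟩ (k | k)
      · simp [abs_of_nonneg ht.1, ht.2]
      · simp)

def LL (f : Ed m × Ed m → ℂ) : Ed m × Ed m → ℂ :=
  ∑ j : Fin m, dd (dv (Sum.inl j)) (dd (dv (Sum.inr j)) f)

theorem SymC.LL {W : ι → Ed m × Ed m → ℝ} (h : SymC dv W b) : SymC dv W (fun p => LL (b p)) :=
  SymC.sum _ fun j => (h.dd (Sum.inr j)).dd (Sum.inl j)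

theorem fst_decomp (w : Ed m) : (w, (0 : Ed m)) = ∑ j, (w j) • dv (Sum.inl j) := by
  have h1 : w = ∑ j, (w j) • (ev j : Ed m) := by
    ext i
    simp [ev, Finset.sum_apply, Pi.single_apply]
  have : (∑ j, (w j) • dv (Sum.inl j) : Ed m × Ed m)
      = ContinuousLinearMap.inl ℝ (Ed m) (Ed m) (∑ j, (w j) • (ev j : Ed m)) := by
    rw [map_sum]; simp
  rw [this, ← h1]; rfl

theorem hasDerivAt_sc {f : Ed m × Ed m → ℂ} (hf : ContDiff ℝ ∞ f) (x : Ed m × Ed m) (t : ℝ) :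
    HasDerivAt (fun t => sc t f x) (∑ j, (x.1 j : ℂ) * sc t (dd (dv (Sum.inl j)) f) x) t := by
  have h1 : HasDerivAt (fun t : ℝ => scA t x) (x.1, 0) t := by
    have := ((hasDerivAt_id t).smul_const x.1).prodMk (hasDerivAt_const t x.2)
    rw [one_smul] at this
    exact this
  have h2 := (smooth_diff hf (scA t x)).hasFDerivAt.comp_hasDerivAt t h1
  have e : (fderiv ℝ f (scA t x)) (x.1, 0) = ∑ j, (x.1 j : ℂ) * sc t (dd (dv (Sum.inl j)) f) x := by
    rw [fst_decomp, map_sum]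
    refine Finset.sum_congr rfl fun j _ => ?_
    rw [map_smul, Complex.real_smul]; rfl
  rw [e] at h2
  exact h2

theorem SymC.hasDerivAt_II (h : SymC dv (fun p x => M p x.2) b) (hM : ∀ p, Integrable (M p))
    (p : ι) (t : ℝ) :
    HasDerivAt (fun t => II (_root_.sc t (b p))) (Complex.I * II (_root_.sc t (_root_.LL (b p)))) t := by
  set N := m + 1 with hNdef
  have hN : m < 2 * N := by omega
  have hN' : m < 2 * (N + 1) := by omega
  have e0 : (fun t => II (_root_.sc t (b p))) = fun t => ∫ x, osk (N + 1) (_root_.sc t (b p)) x := by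
    funext t; exact (h.sc t).II_eq hM hN' p
  have hk : ∀ j : Fin m, ∀ t : ℝ, SymC dv (fun p x => M p x.2)
      (fun p => _root_.sc t (_root_.dd (dv (Sum.inl j)) (b p))) := fun j t => (h.dd (Sum.inl j)).sc t
  set F' : ℝ → Ed m × Ed m → ℂ := fun t x =>
    ∑ j, (x.1 j : ℂ) * osk (N + 1) (_root_.sc t (_root_.dd (dv (Sum.inl j)) (b p))) x with hF'
  choose C hC H using fun j : Fin m => ((h.dd (Sum.inl j)).pz (LN m (N + 1))).bd []
  have hosk : ∀ j t x, osk (N + 1) (_root_.sc t (_root_.dd (dv (Sum.inl j)) (b p))) x =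
      qL (LN m (N + 1)) x.1 * (Complex.exp (Complex.I * ((⟪x.1, x.2⟫ : ℝ) : ℂ)) *
        _root_.sc t (_root_.pz (LN m (N + 1)) (_root_.dd (dv (Sum.inl j)) (b p))) x) := by
    intro j t x
    rw [osk, pz_sc t (dd_smooth (h.smooth p) _)]
  have hd := hasDerivAt_integral_of_dominated_loc_of_deriv_le (𝕜 := ℝ) (μ := (volume : Measure (Ed m × Ed m)))
    (F := fun t x => osk (N + 1) (_root_.sc t (b p)) x) (F' := F') (x₀ := t) (s := Set.univ)
    (bound := fun x => (∑ j, C j) * (Bw x.1 ^ N * M p x.2)) Filter.univ_mem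
    (Eventually.of_forall fun t => (ker_cont ((h.sc t).smooth p) _).aestronglyMeasurable)
    ((h.sc t).ker_int hM hN' p)
    (by
      refine Continuous.aestronglyMeasurable ?_
      refine continuous_finsetSum _ fun j _ => Continuous.mul (by fun_prop) ?_
      exact ker_cont ((hk j t).smooth p) _)
    (Eventually.of_forall fun x s _ => by
      rw [Finset.sum_mul]
      refine (norm_sum_le _ _).trans (Finset.sum_le_sum fun j _ => ?_)
      rw [hosk]
      simp only [norm_mul, norm_exp_I, one_mul]
      have h1 : ‖_root_.sc s (_root_.pz (LN m (N + 1)) (_root_.dd (dv (Sum.inl j)) (b p))) x‖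
          ≤ C j * M p x.2 := H j p (scA s x)
      have h2 := (norm_nonneg _).trans h1
      have h3 := (Bw_pos x.1).le
      calc _ ≤ ‖(x.1 j : ℂ)‖ * (Bw x.1 ^ (N + 1) * (C j * M p x.2)) := by
            refine mul_le_mul_of_nonneg_left ?_ (norm_nonneg _)
            exact mul_le_mul (norm_qL_le _ _) h1 (norm_nonneg _) (pow_nonneg h3 _)
        _ = (‖(x.1 j : ℂ)‖ * Bw x.1) * (Bw x.1 ^ N * (C j * M p x.2)) := by ring
        _ ≤ 1 * (Bw x.1 ^ N * (C j * M p x.2)) :=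
            mul_le_mul_of_nonneg_right (abs_coord_le _ _) (mul_nonneg (pow_nonneg h3 _) h2)
        _ = _ := by ring)
    ((int_prod_weight hN (hM p)).const_mul _)
    (Eventually.of_forall fun x s _ => by
      have h1 := hasDerivAt_sc (pl_smooth (fun j => dv (Sum.inr j)) (LN m (N + 1)) (h.smooth p)) x s
      have h2 := (h1.const_mul (Complex.exp (Complex.I * ((⟪x.1, x.2⟫ : ℝ) : ℂ)))).const_mul
        (qL (LN m (N + 1)) x.1)
      have h3 : (fun t => osk (N + 1) (_root_.sc t (b p)) x) = fun t => qL (LN m (N + 1)) x.1 *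
        (Complex.exp (Complex.I * ((⟪x.1, x.2⟫ : ℝ) : ℂ)) *
          _root_.sc t (_root_.pz (LN m (N + 1)) (b p)) x) := by
        funext t; rw [osk, pz_sc t (h.smooth p)]
      rw [h3]
      have h4 : F' s x = qL (LN m (N + 1)) x.1 *
          (Complex.exp (Complex.I * ((⟪x.1, x.2⟫ : ℝ) : ℂ)) *
            ∑ j, (x.1 j : ℂ) * _root_.sc s (_root_.dd (dv (Sum.inl j))
              (_root_.pl (fun j => dv (Sum.inr j)) (LN m (N + 1)) (b p))) x) := by
        rw [Finset.mul_sum, Finset.mul_sum]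
        refine Finset.sum_congr rfl fun j _ => ?_
        rw [hosk, dd_pl_comm _ _ _ (h.smooth p), _root_.pz]
        ring
      rw [h4]
      exact h2)
  suffices e2 : ∫ x, F' t x = Complex.I * II (_root_.sc t (_root_.LL (b p))) by
    rw [e0, ← e2]
    exact hd.2
  show ∫ x, ∑ j, (x.1 j : ℂ) * osk (N + 1) (_root_.sc t (_root_.dd (dv (Sum.inl j)) (b p))) x = _
  rw [integral_finsetSum _ fun j _ => ((hk j t).coord_ker hM hN p j).1]
  simp_rw [fun j => ((hk j t).coord_ker hM hN p j).2]
  rw [← Finset.mul_sum]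
  congr 1
  have e1 : _root_.sc t (_root_.LL (b p)) =
      ∑ j, _root_.dd (dv (Sum.inr j)) (_root_.sc t (_root_.dd (dv (Sum.inl j)) (b p))) := by
    funext x
    simp_rw [fun j : Fin m => dd_inr_sc t (dd_smooth (h.smooth p) (dv (Sum.inl j))) j]
    simp_rw [fun j : Fin m => dd_comm (h.smooth p) (dv (Sum.inr j)) (dv (Sum.inl j))]
    simp [_root_.sc, _root_.LL, Finset.sum_apply]
  rw [e1]
  exact (SymC.II_sum (M := M) Finset.univ
    (b := fun j p => _root_.dd (dv (Sum.inr j)) (_root_.sc t (_root_.dd (dv (Sum.inl j)) (b p))))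
    (fun j => (hk j t).dd (Sum.inr j)) hM p).symm

theorem fourierInv_eq_fI (φ : Ed m → ℂ) (v : Ed m) : 𝓕⁻ φ v = fI ((2 * π) • v) φ := by
  rw [Real.fourierInv_eq', fI]
  congr 1; funext z
  rw [inner_smul_left, real_inner_comm, smul_eq_mul]
  simp [mul_comm]

theorem fourier_eq_fI (φ : Ed m → ℂ) (v : Ed m) : 𝓕 φ v = fI ((-(2 * π)) • v) φ := by
  rw [Real.fourier_eq', fI]
  congr 1; funext z
  rw [inner_smul_left, real_inner_comm, smul_eq_mul]
  simp [mul_comm]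

theorem SymC.II_sc_zero (h : SymC dv (fun p x => M p x.2) b) (hM : ∀ p, Integrable (M p)) (p : ι) :
    II (_root_.sc 0 (b p)) = ((2 * π) ^ m : ℝ) * b p 0 := by
  set φ : Ed m → ℂ := fun z => b p (0, z) with hφ
  have e1 : ∀ w : Ed m, (fun z => _root_.sc 0 (b p) (w, z)) = φ := by
    intro w; funext z; simp [_root_.sc, scA, hφ]
  have hInt_fI : Integrable (fun w => fI w φ) := by
    have := (h.sc 0).fI_int hM p
    simpa only [e1] using this
  have hφi : Integrable φ := h.int_z hM p 0
  have hc : Continuous φ := (h.smooth p).continuous.comp (by fun_prop)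
  have hF : Integrable (𝓕 φ) := by
    have : 𝓕 φ = fun v => fI ((-(2 * π)) • v) φ := funext (fourier_eq_fI φ)
    rw [this]
    exact hInt_fI.comp_smul (by simp [Real.pi_ne_zero])
  have inv := congrFun (hc.fourier_fourierInv_eq hφi hF) 0
  rw [Real.fourier_eq'] at inv
  simp only [inner_zero_right, mul_zero, Complex.ofReal_zero, zero_mul, Complex.exp_zero, one_smul] at inv
  simp_rw [fourierInv_eq_fI] at inv
  rw [Measure.integral_comp_smul_of_nonneg (hR := by positivity) volume (fun w => fI w φ) (2 * π)] at inv
  unfold II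
  simp_rw [e1]
  have hb : b p 0 = φ 0 := rfl
  rw [hb, ← inv]
  simp only [finrank_euclideanSpace, Fintype.card_fin, Complex.real_smul]
  rw [← mul_assoc, ← Complex.ofReal_mul, mul_inv_cancel₀ (by positivity)]
  simp

end Expansion


section Bound
variable {m : ℕ} {ι : Type*} {M : ι → Ed m → ℝ} {b : ι → Ed m × Ed m → ℂ}

theorem SymC.II_bd (h : SymC dv (fun p x => M p x.2) b) (hM : ∀ p, Integrable (M p))
    (hM0 : ∀ p z, 0 ≤ M p z)
    (C0 : ℝ) (hC0 : 0 ≤ C0) (K : ℕ)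
    (hP : ∀ p z, M p z ≤ C0 * M p 0 * (1 + ‖z‖ ^ 2) ^ K) :
    ∃ C : ℝ, 0 ≤ C ∧ ∀ p, ‖II (b p)‖ ≤ C * M p 0 := by
  set N := m + 1 with hNdef
  have hN : m < 2 * N := by omega
  set c : ι → Ed m × Ed m → ℂ := fun p => (fun x => qL (LN m N) x.1) * _root_.pz (LN m N) (b p) with hc
  have hcS0 : SymC dv (fun p x => ‖qL (LN m N) x.1‖ * M p x.2) c :=
    (symC_qL_fst (LN m N)).mul (h.pz (LN m N))
  have hcS : SymC dv (fun p x => Bw x.1 ^ N * M p x.2) c :=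
    hcS0.mono ⟨1, zero_le_one, fun p x => by
      rw [one_mul]; exact mul_le_mul_of_nonneg_right (norm_qL_le _ _) (hM0 _ _)⟩
  have hBi := integrable_Bw (m := m) hN
  have hsl : ∀ (c' : ι → Ed m × Ed m → ℂ), SymC dv (fun p x => Bw x.1 ^ N * M p x.2) c' →
      ∀ p z, Integrable (fun w => c' p (w, z)) := by
    intro c' hc' p z
    obtain ⟨C, hC, H⟩ := hc'.bd []
    refine ((hBi.mul_const (M p z)).const_mul C).mono' ?_ (Eventually.of_forall fun w => H p (w, z))
    exact ((hc'.smooth p).continuous.comp (by fun_prop)).aestronglyMeasurable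
  set S := N + K with hS
  have e1 : ∀ p, II (b p) = ∫ z, fI z (fun w => c p (w, z)) := by
    intro p
    have hi := h.ker_int hM hN p
    rw [h.II_eq hM hN p]
    rw [Measure.volume_eq_prod] at hi ⊢
    rw [integral_prod_symm _ hi]
    congr 1; funext z
    unfold fI
    congr 1; funext w
    simp only [osk, hc, Pi.mul_apply]
    rw [real_inner_comm w z]
    ring
  have e2 : ∀ p z, fI z (fun w => c p (w, z)) =
      qL (LN m S) z * fI z (fun w => _root_.pw (LN m S) (c p) (w, z)) := by
    intro p z
    rw [fI_pl (LN m S) z (φ := fun w => c p (w, z)) ((hcS.smooth p).comp (by fun_prop)),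
      pl_slice_w (hcS.smooth p)]
    intro l
    rw [ddl_slice_w (hcS.smooth p)]
    exact hsl _ (hcS.ddl _) p z
  obtain ⟨C, hC, H⟩ := (hcS.pw (LN m S)).bd []
  set B := ∫ w : Ed m, Bw w ^ N with hB
  have hB0 : 0 ≤ B := integral_nonneg fun w => pow_nonneg (Bw_pos w).le _
  have e3 : ∀ p z, ‖fI z (fun w => _root_.pw (LN m S) (c p) (w, z))‖ ≤ C * B * M p z := by
    intro p z
    have : C * B * M p z = ∫ w : Ed m, C * (Bw w ^ N * M p z) := by
      rw [integral_const_mul, integral_mul_const]; ring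
    rw [this]
    refine norm_integral_le_of_norm_le ((hBi.mul_const _).const_mul C) (Eventually.of_forall fun w => ?_)
    rw [norm_mul, norm_exp_I, one_mul]
    exact H p (w, z)
  clear_value S B c
  refine ⟨C * B * C0 * B, by positivity, fun p => ?_⟩
  have : C * B * C0 * B * M p 0 = ∫ z : Ed m, (C * B * C0 * M p 0) * Bw z ^ N := by
    rw [integral_const_mul, ← hB]; ring
  rw [e1, this]
  refine norm_integral_le_of_norm_le (hBi.const_mul _) (Eventually.of_forall fun z => ?_)
  rw [e2, norm_mul]
  have hz : Bw z ^ K * (1 + ‖z‖ ^ 2) ^ K = 1 := by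
    rw [← mul_pow, Bw, inv_mul_cancel₀ (by positivity), one_pow]
  have hb := (Bw_pos z).le
  have hSp : Bw z ^ S = Bw z ^ N * Bw z ^ K := by rw [hS, pow_add]
  calc _ ≤ Bw z ^ S * (C * B * M p z) :=
        mul_le_mul (norm_qL_le _ _) (e3 p z) (norm_nonneg _) (pow_nonneg hb _)
    _ ≤ Bw z ^ S * (C * B * (C0 * M p 0 * (1 + ‖z‖ ^ 2) ^ K)) := by
        refine mul_le_mul_of_nonneg_left (mul_le_mul_of_nonneg_left (hP p z) ?_) (pow_nonneg hb _)
        positivity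
    _ = C * B * C0 * M p 0 * Bw z ^ N * (Bw z ^ K * (1 + ‖z‖ ^ 2) ^ K) := by rw [hSp]; ring
    _ = _ := by rw [hz, mul_one]

/-- Normalised oscillatory functional. -/
def GG (t : ℝ) (f : Ed m × Ed m → ℂ) : ℂ := (((2 * π) ^ m : ℝ) : ℂ)⁻¹ * II (sc t f)

theorem iter_LL_succ (n : ℕ) (f : Ed m × Ed m → ℂ) : LL^[n + 1] f = LL^[n] (LL f) :=
  Function.iterate_succ_apply _ _ _

theorem taylor_bd (n : ℕ) : ∀ {b : ι → Ed m × Ed m → ℂ},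
    SymC dv (fun p x => M p x.2) b → (∀ p, Integrable (M p)) → ∀ (p : ι) (B : ℝ),
    (∀ t ∈ Set.Icc (0 : ℝ) 1, ‖GG t (LL^[n] (b p))‖ ≤ B) →
    ∀ t ∈ Set.Icc (0 : ℝ) 1, ‖GG t (b p) -
      ∑ s ∈ Finset.range n, (Complex.I * (t : ℂ)) ^ s / (Nat.factorial s : ℂ) * (LL^[s] (b p) 0)‖ ≤ B := by
  induction n with
  | zero =>
    intro b h hM p B hB t ht
    simpa using hB t ht
  | succ n ih =>
    intro b h hM p B hB t ht
    have hB0 : 0 ≤ B := (norm_nonneg _).trans (hB t ht)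
    have IH := ih (h.LL) hM p B (by simpa only [iter_LL_succ] using hB)
    set f : ℝ → ℂ := fun t => GG t (b p) - ∑ s ∈ Finset.range (n + 1),
      (Complex.I * (t : ℂ)) ^ s / (Nat.factorial s : ℂ) * (LL^[s] (b p) 0) with hf
    set f' : ℝ → ℂ := fun t => Complex.I * (GG t (LL (b p)) - ∑ s ∈ Finset.range n,
      (Complex.I * (t : ℂ)) ^ s / (Nat.factorial s : ℂ) * (LL^[s] (LL (b p)) 0)) with hf'
    have hpi : (((2 * π) ^ m : ℝ) : ℂ) ≠ 0 := by
      rw [Complex.ofReal_ne_zero]; positivity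
    have f0 : f 0 = 0 := by
      simp only [hf, GG, h.II_sc_zero hM p]
      rw [inv_mul_cancel_left₀ hpi, Finset.sum_range_succ']
      simp
    have hder : ∀ t, HasDerivAt f (f' t) t := by
      intro t
      have h1 := (h.hasDerivAt_II hM p t).const_mul ((((2 * π) ^ m : ℝ) : ℂ)⁻¹)
      have h2 : ∀ s : ℕ, HasDerivAt (fun t : ℝ => (Complex.I * (t : ℂ)) ^ (s + 1) /
          (Nat.factorial (s + 1) : ℂ) * (LL^[s + 1] (b p) 0))
          (Complex.I * ((Complex.I * (t : ℂ)) ^ s / (Nat.factorial s : ℂ) * (LL^[s] (LL (b p)) 0))) t := by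
        intro s
        have g1 : HasDerivAt (fun t : ℝ => Complex.I * (t : ℂ)) Complex.I t := by
          simpa using (Complex.ofRealCLM.hasDerivAt (x := t)).const_mul Complex.I
        have g2 := ((g1.pow (s + 1)).div_const (Nat.factorial (s + 1) : ℂ)).mul_const (LL^[s + 1] (b p) 0)
        refine g2.congr_deriv ?_
        rw [iter_LL_succ, Nat.factorial_succ]
        have : (Nat.factorial s : ℂ) ≠ 0 := by exact_mod_cast Nat.factorial_ne_zero s
        have : (s : ℂ) + 1 ≠ 0 := by exact_mod_cast Nat.succ_ne_zero s
        push_cast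
        field_simp
      have h3 := h1.sub (HasDerivAt.fun_sum (u := Finset.range n) fun s _ => h2 s)
      have h4 := h3.sub_const (b p 0)
      have e1 : f = fun t => ((((2 * π) ^ m : ℝ) : ℂ)⁻¹ * II (sc t (b p)) - ∑ s ∈ Finset.range n,
         (Complex.I * (t : ℂ)) ^ (s + 1) /
          (Nat.factorial (s + 1) : ℂ) * (LL^[s + 1] (b p) 0)) - b p 0 := by
        funext t
        simp only [hf, GG]
        rw [Finset.sum_range_succ']
        simp
        ring
      rw [e1]
      refine h4.congr_deriv ?_
      simp only [hf', GG, Finset.mul_sum, mul_sub]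
      congr 1
      ring
    have key := norm_image_sub_le_of_norm_deriv_le_segment' (f := f) (f' := f') (a := 0) (b := 1) (C := B)
      (fun x _ => (hder x).hasDerivWithinAt) (fun x hx => by
        simp only [hf', norm_mul, Complex.norm_I, one_mul]
        exact IH x ⟨hx.1, hx.2.le⟩) t ht
    rw [f0, sub_zero, sub_zero] at key
    refine key.trans ?_
    exact mul_le_of_le_one_right hB0 ht.2

theorem ddl_sum {F κ J : Type*} [NormedAddCommGroup F] [NormedSpace ℝ F] (v : κ → F) (l : List κ)
    (s : Finset J) {f : J → F → ℂ} (hf : ∀ j, ContDiff ℝ ∞ (f j)) :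
    ContDiff ℝ ∞ (∑ j ∈ s, f j) ∧ ddl v l (∑ j ∈ s, f j) = ∑ j ∈ s, ddl v l (f j) := by
  classical
  induction s using Finset.induction_on with
  | empty => exact ⟨(contDiff_const : ContDiff ℝ ∞ fun _ : F => (0 : ℂ)), by simp [ddl_zero]⟩
  | insert j s hj ih =>
    rw [Finset.sum_insert hj, Finset.sum_insert hj, ddl_add _ _ (hf j) ih.1, ih.2]
    exact ⟨(hf j).add ih.1, rfl⟩

theorem ddl_LL (l : List (Fin m ⊕ Fin m)) {f : Ed m × Ed m → ℂ} (hf : ContDiff ℝ ∞ f) :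
    ddl dv l (LL f) = ∑ j : Fin m, ddl dv (Sum.inr j :: Sum.inl j :: l) f :=
  (ddl_sum dv l Finset.univ
    (f := fun j : Fin m => dd (dv (Sum.inl j)) (dd (dv (Sum.inr j)) f))
    (fun j => dd_smooth (dd_smooth hf _) _)).2

theorem LL_smooth {f : Ed m × Ed m → ℂ} (hf : ContDiff ℝ ∞ f) : ContDiff ℝ ∞ (LL f) :=
  (ddl_sum dv [] Finset.univ
    (f := fun j : Fin m => dd (dv (Sum.inl j)) (dd (dv (Sum.inr j)) f))
    (fun j => dd_smooth (dd_smooth hf _) _)).1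

theorem iter_LL_bd (δ : ι → ℝ) (n : ℕ) : ∀ {b : ι → Ed m × Ed m → ℂ} {q : ℕ},
    (∀ p, ContDiff ℝ ∞ (b p)) →
    (∀ l, ∃ C : ℝ, 0 ≤ C ∧ ∀ p x, ‖ddl dv l (b p) x‖ ≤ C * (δ p ^ (q + l.length) * M p x.2)) →
    (∀ p, ContDiff ℝ ∞ (LL^[n] (b p))) ∧
    (∀ l, ∃ C : ℝ, 0 ≤ C ∧ ∀ p x, ‖ddl dv l (LL^[n] (b p)) x‖ ≤
      C * (δ p ^ (q + 2 * n + l.length) * M p x.2)) := by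
  induction n with
  | zero => intro b q hb h; exact ⟨hb, h⟩
  | succ n ih =>
    intro b q hb h
    simp only [iter_LL_succ]
    have := ih (b := fun p => LL (b p)) (q := q + 2) (fun p => LL_smooth (hb p)) ?_
    · rw [show q + 2 * (n + 1) = q + 2 + 2 * n by ring]; exact this
    intro l
    choose C hC H using fun j : Fin m => h (Sum.inr j :: Sum.inl j :: l)
    refine ⟨∑ j, C j, Finset.sum_nonneg fun j _ => hC j, fun p x => ?_⟩
    rw [ddl_LL l (hb p), Finset.sum_apply, Finset.sum_mul]
    refine (norm_sum_le _ _).trans (Finset.sum_le_sum fun j _ => ?_)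
    have := H j p x
    simp only [List.length_cons] at this
    rw [show q + 2 + l.length = q + (l.length + 1 + 1) by ring]
    exact this

theorem main_abs (δ : ι → ℝ) (hδ : ∀ p, 0 ≤ δ p) (hδ1 : ∀ p, δ p ≤ 1)
    (hM : ∀ p, Integrable (M p)) (hM0 : ∀ p z, 0 ≤ M p z)
    (C0 : ℝ) (hC0 : 0 ≤ C0) (K : ℕ)
    (hP : ∀ p z, M p z ≤ C0 * M p 0 * (1 + ‖z‖ ^ 2) ^ K)
    (hb : ∀ p, ContDiff ℝ ∞ (b p))
    (h : ∀ l, ∃ C : ℝ, 0 ≤ C ∧ ∀ p x, ‖ddl dv l (b p) x‖ ≤ C * (δ p ^ l.length * M p x.2)) (n : ℕ) :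
    ∃ C : ℝ, 0 ≤ C ∧ ∀ p, ‖(((2 * π) ^ m : ℝ) : ℂ)⁻¹ * II (b p) -
      ∑ s ∈ Finset.range n, Complex.I ^ s / (Nat.factorial s : ℂ) * (LL^[s] (b p) 0)‖ ≤
        C * (δ p ^ (2 * n) * M p 0) := by
  have hS : SymC dv (fun p x => M p x.2) b := by
    refine ⟨hb, fun l => ?_⟩
    obtain ⟨C, hC, H⟩ := h l
    refine ⟨C, hC, fun p x => (H p x).trans (mul_le_mul_of_nonneg_left ?_ hC)⟩
    exact mul_le_of_le_one_left (hM0 _ _) (pow_le_one₀ (hδ p) (hδ1 p))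
  have hn := iter_LL_bd δ n (b := b) (q := 0) hb (by simpa using h)
  have hSn : SymC dv (fun p x => (fun p z => δ p ^ (2 * n) * M p z) p x.2) (fun p => LL^[n] (b p)) := by
    refine ⟨hn.1, fun l => ?_⟩
    obtain ⟨C, hC, H⟩ := hn.2 l
    refine ⟨C, hC, fun p x => (H p x).trans (mul_le_mul_of_nonneg_left ?_ hC)⟩
    refine mul_le_mul_of_nonneg_right ?_ (hM0 _ _)
    exact pow_le_pow_of_le_one (hδ p) (hδ1 p) (by omega)
  obtain ⟨C, hC, H⟩ := SymC.II_bd (SymC.sc01 (M := fun p z => δ p ^ (2 * n) * M p z) hSn) (M := fun (q : ι × Set.Icc (0 : ℝ) 1) z => δ q.1 ^ (2 * n) * M q.1 z)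
    (fun q => (hM q.1).const_mul _) (fun q z => mul_nonneg (pow_nonneg (hδ _) _) (hM0 _ _)) C0 hC0 K
    (fun q z => by
      calc _ ≤ δ q.1 ^ (2 * n) * (C0 * M q.1 0 * (1 + ‖z‖ ^ 2) ^ K) :=
            mul_le_mul_of_nonneg_left (hP _ _) (pow_nonneg (hδ _) _)
        _ = _ := by ring)
  refine ⟨‖(((2 * π) ^ m : ℝ) : ℂ)⁻¹‖ * C, by positivity, fun p => ?_⟩
  have := taylor_bd n hS hM p (‖(((2 * π) ^ m : ℝ) : ℂ)⁻¹‖ * C * (δ p ^ (2 * n) * M p 0))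
    (fun t ht => by
      rw [GG, norm_mul, mul_assoc]
      exact mul_le_mul_of_nonneg_left (H (p, ⟨t, ht⟩)) (norm_nonneg _)) 1 ⟨zero_le_one, le_rfl⟩
  have e1 : sc 1 (b p) = b p := by funext x; simp [sc, scA]
  simpa [GG, e1] using this

end Bound


section Transfer
variable {d : ℕ}

/-- Identification of Euclidean `(d+1)`-space with `ℝ × ℝᵈ`. -/
def Phi : Ed (d + 1) →L[ℝ] (ℝ × Ed d) :=
  LinearMap.toContinuousLinearMap
    { toFun := fun z => (z 0, WithLp.toLp 2 (fun i : Fin d => z i.succ))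
      map_add' := fun a b => by
        refine Prod.ext ?_ ?_
        · simp
        · ext i; simp
      map_smul' := fun a b => by
        refine Prod.ext ?_ ?_
        · simp
        · ext i; simp }

theorem Phi_apply (z : Ed (d + 1)) : Phi z = (z 0, WithLp.toLp 2 (fun i : Fin d => z i.succ)) := rfl

theorem Phi_surj (ξ : ℝ × Ed d) : ∃ z : Ed (d + 1), Phi z = ξ :=
  ⟨WithLp.toLp 2 (Fin.cons ξ.1 ξ.2), by
    rw [Phi_apply]
    refine Prod.ext ?_ ?_
    · simp
    · ext i; simp⟩

theorem xiNorm_Phi (z : Ed (d + 1)) : xiNorm d (Phi z) = ‖z‖ := by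
  rw [xiNorm, EuclideanSpace.norm_sq_eq, EuclideanSpace.norm_eq z, Fin.sum_univ_succ]
  simp [Phi_apply]

theorem epair_Phi (w z : Ed (d + 1)) : epair d (Phi w) (Phi z) = ⟪w, z⟫ := by
  rw [epair, PiLp.inner_apply, PiLp.inner_apply, Fin.sum_univ_succ]
  simp [Phi_apply, mul_comm]

theorem Phi_ev_zero : Phi (ev 0 : Ed (d + 1)) = (1, 0) := by
  rw [Phi_apply]
  refine Prod.ext ?_ ?_
  · simp [ev]
  · ext i; simp [ev]

theorem Phi_ev_succ (i : Fin d) : Phi (ev i.succ : Ed (d + 1)) = (0, EuclideanSpace.single i 1) := by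
  rw [Phi_apply]
  refine Prod.ext ?_ ?_
  · simp [ev]
  · ext j; simp [ev, Pi.single_apply]

theorem Phi_inj : Function.Injective (Phi : Ed (d + 1) → _) := by
  intro a b hab
  rw [Phi_apply, Phi_apply] at hab
  ext i
  refine Fin.cases ?_ (fun j => ?_) i
  · exact congrArg Prod.fst hab
  · have := congrArg (fun q : ℝ × Ed d => q.2 j) hab
    simpa using this

theorem Phi_emb : MeasurableEmbedding (Phi : Ed (d + 1) → ℝ × Ed d) :=
  (Phi (d := d)).continuous.measurableEmbedding Phi_inj

theorem Phi_mp : MeasurePreserving (Phi : Ed (d + 1) → ℝ × Ed d) volume volume := by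
  have h1 := PiLp.volume_preserving_ofLp (Fin (d + 1))
  have h2 := volume_preserving_piFinSuccAbove (fun _ : Fin (d + 1) => ℝ) 0
  have h3 := (MeasurePreserving.id (volume : Measure ℝ)).prod (PiLp.volume_preserving_toLp (Fin d))
  exact h3.comp (h2.comp h1)

theorem cov {F : ℝ × Ed d → ℂ} (x : ℝ × Ed d) {α : ℝ} (hα : 0 < α) :
    ∫ u, F u = ((α ^ (d + 1) : ℝ) : ℂ) * ∫ w : Ed (d + 1), F (x + α • Phi w) := by
  have e1 : ∫ u, F u = ∫ w : Ed (d + 1), F (x + Phi w) := by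
    rw [Phi_mp.integral_comp Phi_emb (fun u => F (x + u))]
    haveI : (volume : Measure (ℝ × Ed d)).IsAddLeftInvariant := by
      rw [Measure.volume_eq_prod]; infer_instance
    exact (integral_add_left_eq_self F x).symm
  have e2 : ∫ w : Ed (d + 1), F (x + α • Phi w) = ∫ w : Ed (d + 1), (fun w => F (x + Phi w)) (α • w) := by
    simp
  rw [e2, Measure.integral_comp_smul_of_nonneg (hR := hα.le) volume (fun w => F (x + Phi w)) α, e1]
  simp only [finrank_euclideanSpace, Fintype.card_fin, Complex.real_smul]
  rw [← mul_assoc, ← Complex.ofReal_mul, mul_inv_cancel₀ (by positivity)]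
  simp

end Transfer

section Lists
variable {F κ : Type*} [NormedAddCommGroup F] [NormedSpace ℝ F]

theorem ddl_iter (v : κ → F) (l : List κ) : ∃ μ : Fin l.length → F, (∀ i, ∃ k, μ i = v k) ∧
    ∀ {f : F → ℂ}, ContDiff ℝ ∞ f → ∀ x, ddl v l f x = iteratedFDeriv ℝ l.length f x μ := by
  induction l with
  | nil => exact ⟨Fin.elim0, fun i => i.elim0, fun hf x => by simp [ddl]⟩
  | cons k l ih =>
    obtain ⟨μ, hμ, H⟩ := ih
    refine ⟨Fin.snoc (α := fun _ => F) μ (v k), fun i => ?_, fun {f} hf x => ?_⟩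
    · refine Fin.lastCases ⟨k, by simp⟩ (fun j => ?_) i
      simpa using hμ j
    · have h1 := H (dd_smooth hf (v k)) x
      simp only [ddl]
      rw [h1]
      have h2 := iteratedFDeriv_succ_apply_right (𝕜 := ℝ) (f := f) (x := x)
        (n := l.length) (Fin.snoc (α := fun _ => F) μ (v k))
      refine Eq.trans ?_ h2.symm
      rw [Fin.init_snoc, Fin.snoc_last]
      have h3 := (ContinuousLinearMap.apply ℝ ℂ (v k)).iteratedFDeriv_comp_left (x := x)
        (f := fun y => fderiv ℝ f y) (n := ∞)
        ((hf.fderiv_right (m := ∞) (by simp)).contDiffAt) (i := l.length) (by exact_mod_cast le_top)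
      have h4 : dd (v k) f = (ContinuousLinearMap.apply ℝ ℂ (v k)) ∘ fun y => fderiv ℝ f y := rfl
      rw [h4, h3]
      rfl

theorem split_list (l : List (κ ⊕ κ)) : ∃ lr ll : List κ, l.Perm (lr.map Sum.inr ++ ll.map Sum.inl) := by
  induction l with
  | nil => exact ⟨[], [], by simp⟩
  | cons k l ih =>
    obtain ⟨lr, ll, h⟩ := ih
    rcases k with k | k
    · refine ⟨lr, k :: ll, (h.cons _).trans ?_⟩
      simpa using (List.perm_middle).symm
    · exact ⟨k :: lr, ll, h.cons _⟩

/-- Vectors on the two factors. -/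
def v2 (v : κ → F) : κ ⊕ κ → F × F := Sum.elim (fun k => (v k, 0)) (fun k => (0, v k))

theorem slice_iter_smooth {G : F × F → ℂ} (hG : ContDiff ℝ ∞ G) (c : ℕ) (z : F) :
    ContDiff ℝ ∞ (fun w : F => iteratedFDeriv ℝ c (fun z => G (w, z)) z) := by
  have : (fun w : F => iteratedFDeriv ℝ c (fun z => G (w, z)) z) = fun w =>
      ContinuousMultilinearMap.compContinuousLinearMapL (𝕜 := ℝ) (F := ℂ)
        (fun _ : Fin c => ContinuousLinearMap.inr ℝ F F)
        (iteratedFDeriv ℝ c G (w, z)) := by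
    funext w
    have h1 := (ContinuousLinearMap.inr ℝ F F).iteratedFDeriv_comp_right
      (f := fun q : F × F => G ((w, 0) + q)) (n := ∞) (hG.comp (by fun_prop)) z (i := c)
      (by exact_mod_cast le_top)
    have h2 : (fun q : F × F => G ((w, 0) + q)) ∘ (ContinuousLinearMap.inr ℝ F F) = fun z => G (w, z) := by
      funext z; simp
    rw [h2, iteratedFDeriv_comp_add_left] at h1
    rw [h1]
    simp
  rw [this]
  refine (ContinuousLinearMap.contDiff _).comp ?_
  refine ContDiff.comp (g := iteratedFDeriv ℝ c G) (hG.iteratedFDeriv_right (m := ∞) ?_) (by fun_prop)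
  exact_mod_cast le_top

theorem ddl_le_iter (v : κ → F) (hv : ∀ k, ‖v k‖ ≤ 1) (lr ll : List κ) {G : F × F → ℂ}
    (hG : ContDiff ℝ ∞ G) (x : F × F) :
    ‖ddl (v2 v) (lr.map Sum.inr ++ ll.map Sum.inl) G x‖ ≤
      ‖iteratedFDeriv ℝ ll.length (fun w => iteratedFDeriv ℝ lr.length (fun z => G (w, z)) x.2) x.1‖ := by
  obtain ⟨μ, hμ, H⟩ := ddl_iter v lr
  obtain ⟨ν, hν, K⟩ := ddl_iter v ll
  have hμ1 : ∀ i, ‖μ i‖ ≤ 1 := fun i => by obtain ⟨k, hk⟩ := hμ i; rw [hk]; exact hv k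
  have hν1 : ∀ i, ‖ν i‖ ≤ 1 := fun i => by obtain ⟨k, hk⟩ := hν i; rw [hk]; exact hv k
  have e1 : ∀ w, ddl (v2 v) (lr.map Sum.inr) G (w, x.2) =
      iteratedFDeriv ℝ lr.length (fun z => G (w, z)) x.2 μ := by
    intro w
    have h1 := ddl_comp (A := fun z : F => (w, z)) (by fun_prop) (fun z => hasFDerivAt_prodMk_right w z)
      (v := v) (v' := v2 v ∘ Sum.inr) (c := fun _ => 1) (by intro k; simp [v2]) lr hG
    rw [ddl_map, ← H (f := fun z => G (w, z)) (hG.comp (by fun_prop))]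
    have h2 := congrFun h1 x.2
    simpa [Function.comp_def] using h2.symm
  have e2 : ddl (v2 v) (lr.map Sum.inr ++ ll.map Sum.inl) G x =
      ddl v ll (fun w => ddl (v2 v) (lr.map Sum.inr) G (w, x.2)) x.1 := by
    rw [ddl_append, ddl_map]
    have h1 := ddl_comp (A := fun w : F => (w, x.2)) (by fun_prop)
      (fun w => hasFDerivAt_prodMk_left w x.2)
      (v := v) (v' := v2 v ∘ Sum.inl) (c := fun _ => 1) (by intro k; simp [v2]) ll
      (ddl_smooth (v2 v) (lr.map Sum.inr) hG)
    have h2 := congrFun h1 x.1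
    simpa [Function.comp_def] using h2.symm
  have hs := slice_iter_smooth hG lr.length x.2
  have e3 : (fun w => ddl (v2 v) (lr.map Sum.inr) G (w, x.2)) =
      (ContinuousMultilinearMap.apply ℝ (fun _ : Fin lr.length => F) ℂ μ) ∘
        fun w => iteratedFDeriv ℝ lr.length (fun z => G (w, z)) x.2 := funext e1
  rw [e2, e3, K ((ContinuousLinearMap.contDiff _).comp hs),
    ContinuousLinearMap.iteratedFDeriv_comp_left (n := ∞) _ hs.contDiffAt (by exact_mod_cast le_top)]
  set T := iteratedFDeriv ℝ ll.length (fun w => iteratedFDeriv ℝ lr.length (fun z => G (w, z)) x.2) x.1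
  show ‖(T ν) μ‖ ≤ ‖T‖
  have p1 : ∏ i, ‖μ i‖ ≤ 1 := Finset.prod_le_one (fun _ _ => norm_nonneg _) fun i _ => hμ1 i
  have p2 : ∏ i, ‖ν i‖ ≤ 1 := Finset.prod_le_one (fun _ _ => norm_nonneg _) fun i _ => hν1 i
  calc _ ≤ ‖T ν‖ * ∏ i, ‖μ i‖ := ContinuousMultilinearMap.le_opNorm _ _
    _ ≤ ‖T ν‖ * 1 := mul_le_mul_of_nonneg_left p1 (norm_nonneg _)
    _ ≤ (‖T‖ * ∏ i, ‖ν i‖) * 1 :=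
        mul_le_mul_of_nonneg_right (ContinuousMultilinearMap.le_opNorm _ _) zero_le_one
    _ ≤ (‖T‖ * 1) * 1 := by gcongr
    _ = _ := by ring

theorem ddl_eq_zero (v : κ → F) {S : Set F} (hS : IsOpen S) (l : List κ) :
    ∀ {f : F → ℂ}, (∀ x ∈ S, f x = 0) → ∀ x ∈ S, ddl v l f x = 0 := by
  induction l with
  | nil => intro f hf; exact hf
  | cons k l ih =>
    intro f hf
    refine ih (f := dd (v k) f) fun x hx => ?_
    have : f =ᶠ[𝓝 x] fun _ => 0 := by
      filter_upwards [hS.mem_nhds hx] with y hy using hf y hy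
    rw [dd, this.fderiv_eq]; simp

end Lists


section Grad
variable {d : ℕ}

/-- Coordinate vectors on `ℝ × ℝᵈ`. -/
def hv (j : Fin (d + 1)) : ℝ × Ed d := Phi (ev j)

theorem hv_norm (j : Fin (d + 1)) : ‖(hv j : ℝ × Ed d)‖ ≤ 1 := by
  refine Fin.cases ?_ (fun i => ?_) j
  · rw [hv, Phi_ev_zero]; simp [Prod.norm_def]
  · rw [hv, Phi_ev_succ]; simp [Prod.norm_def]

def LH (f : (ℝ × Ed d) × (ℝ × Ed d) → ℂ) : (ℝ × Ed d) × (ℝ × Ed d) → ℂ :=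
  ∑ j : Fin (d + 1), dd (v2 hv (Sum.inl j)) (dd (v2 hv (Sum.inr j)) f)

theorem LH_smooth {f : (ℝ × Ed d) × (ℝ × Ed d) → ℂ} (hf : ContDiff ℝ ∞ f) : ContDiff ℝ ∞ (LH f) :=
  (ddl_sum (v2 hv) [] Finset.univ
    (f := fun j : Fin (d + 1) => dd (v2 hv (Sum.inl j)) (dd (v2 hv (Sum.inr j)) f))
    (fun _ => dd_smooth (dd_smooth hf _) _)).1

theorem slice_dd {F : Type*} [NormedAddCommGroup F] [NormedSpace ℝ F] {G : F × F → ℂ}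
    (hG : ContDiff ℝ ∞ G) (u u' w z : F) :
    fderiv ℝ (fun w' => fderiv ℝ (fun z' => G (w', z')) z u) w u' = dd (u', 0) (dd (0, u) G) (w, z) := by
  have e1 : (fun w' => fderiv ℝ (fun z' => G (w', z')) z u) = fun w' => dd (0, u) G (w', z) := by
    funext w'
    have := ((smooth_diff hG (w', z)).hasFDerivAt.comp z (hasFDerivAt_prodMk_right w' z)).fderiv
    have h2 := congrArg (fun T : F →L[ℝ] ℂ => T u) this
    simpa [dd, Function.comp_def] using h2
  rw [e1]
  have hp : HasFDerivAt (fun e : F => (e, z)) (ContinuousLinearMap.inl ℝ F F) w :=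
    hasFDerivAt_prodMk_left w z
  have := (HasFDerivAt.comp (g := dd (0, u) G) (f := fun e : F => (e, z)) w
    (smooth_diff (dd_smooth hG (0, u)) (w, z)).hasFDerivAt hp).fderiv
  have h2 := congrArg (fun T : F →L[ℝ] ℂ => T u') this
  simpa [dd, Function.comp_def] using h2

theorem gradDot_eq {G : (ℝ × Ed d) × (ℝ × Ed d) → ℂ} (hG : ContDiff ℝ ∞ G) :
    gradDot d (fun w z => G (w, z)) = fun w z => LH G (w, z) := by
  funext w z
  unfold gradDot
  simp only [slice_dd hG]
  rw [LH, Finset.sum_apply, Fin.sum_univ_succ]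
  simp only [v2, Sum.elim_inl, Sum.elim_inr, hv, Phi_ev_zero, Phi_ev_succ]

theorem gradDot_iter (s : ℕ) : ∀ {G : (ℝ × Ed d) × (ℝ × Ed d) → ℂ}, ContDiff ℝ ∞ G →
    (gradDot d)^[s] (fun w z => G (w, z)) = fun w z => LH^[s] G (w, z) := by
  induction s with
  | zero => intro G hG; rfl
  | succ s ih =>
    intro G hG
    rw [Function.iterate_succ_apply, gradDot_eq hG, ih (LH_smooth hG)]
    rfl

/-- The rescaling map. -/
def AA (x ξ : ℝ × Ed d) (α β : ℝ) (q : Ed (d + 1) × Ed (d + 1)) : (ℝ × Ed d) × (ℝ × Ed d) :=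
  (x + α • Phi q.1, ξ + β • Phi q.2)

def AA' (α β : ℝ) : (Ed (d + 1) × Ed (d + 1)) →L[ℝ] (ℝ × Ed d) × (ℝ × Ed d) :=
  ((α • Phi).comp (ContinuousLinearMap.fst ℝ (Ed (d + 1)) (Ed (d + 1)))).prod
    ((β • Phi).comp (ContinuousLinearMap.snd ℝ (Ed (d + 1)) (Ed (d + 1))))

theorem AA_eq (x ξ : ℝ × Ed d) (α β : ℝ) : AA x ξ α β = fun q => (x, ξ) + AA' α β q := by
  funext q
  rfl

theorem AA_deriv (x ξ : ℝ × Ed d) (α β : ℝ) (q : Ed (d + 1) × Ed (d + 1)) :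
    HasFDerivAt (AA x ξ α β) (AA' α β) q := by
  rw [AA_eq]
  exact (AA' α β).hasFDerivAt.const_add _

theorem AA_smooth (x ξ : ℝ × Ed d) (α β : ℝ) : ContDiff ℝ ∞ (AA x ξ α β) := by
  rw [AA_eq]
  exact contDiff_const.add (AA' α β).contDiff

theorem AA'_dv (α β : ℝ) (k : Fin (d + 1) ⊕ Fin (d + 1)) :
    AA' α β (dv k) = (Sum.elim (fun _ => α) (fun _ => β) k : ℝ) • v2 hv k := by
  rcases k with k | k
  · simp [AA', v2, hv]
  · simp [AA', v2, hv]

theorem LL_comp (x ξ : ℝ × Ed d) (α β : ℝ) {G : (ℝ × Ed d) × (ℝ × Ed d) → ℂ} (hG : ContDiff ℝ ∞ G) :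
    LL (G ∘ AA x ξ α β) = ((α * β : ℝ) : ℂ) • (LH G ∘ AA x ξ α β) := by
  unfold LL
  have : ∀ j : Fin (d + 1), dd (dv (Sum.inl j)) (dd (dv (Sum.inr j)) (G ∘ AA x ξ α β)) =
      ((α * β : ℝ) : ℂ) • (dd (v2 hv (Sum.inl j)) (dd (v2 hv (Sum.inr j)) G) ∘ AA x ξ α β) := by
    intro j
    have := ddl_comp (AA_smooth x ξ α β) (AA_deriv x ξ α β) (AA'_dv α β) [Sum.inr j, Sum.inl j] hG
    simp only [ddl, List.map_cons, List.map_nil, List.prod_cons, List.prod_nil, Sum.elim_inl,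
      Sum.elim_inr, mul_one] at this
    rw [mul_comm α β]
    exact this
  simp_rw [this]
  rw [← Finset.smul_sum]
  congr 1
  funext q
  simp [LH, Finset.sum_apply]

theorem LL_smul {m : ℕ} (c : ℂ) {f : Ed m × Ed m → ℂ} (hf : ContDiff ℝ ∞ f) : LL (c • f) = c • LL f := by
  unfold LL
  rw [Finset.smul_sum]
  refine Finset.sum_congr rfl fun j _ => ?_
  rw [dd_smul hf, dd_smul (dd_smooth hf _)]

theorem LL_iter_comp (x ξ : ℝ × Ed d) (α β : ℝ) (s : ℕ) :
    ∀ {G : (ℝ × Ed d) × (ℝ × Ed d) → ℂ}, ContDiff ℝ ∞ G →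
    LL^[s] (G ∘ AA x ξ α β) = (((α * β : ℝ) : ℂ) ^ s) • (LH^[s] G ∘ AA x ξ α β) := by
  induction s with
  | zero => intro G hG; simp
  | succ s ih =>
    intro G hG
    have hs : ContDiff ℝ ∞ (LH^[s] G) := by
      clear ih
      induction s with
      | zero => exact hG
      | succ s ih => rw [Function.iterate_succ_apply']; exact LH_smooth ih
    rw [Function.iterate_succ_apply', Function.iterate_succ_apply', ih hG,
      LL_smul _ (hs.comp (AA_smooth x ξ α β)), LL_comp x ξ α β hs, smul_smul, pow_succ]

theorem smooth_glue {ε y : ℝ} (hε : 0 < ε) (hy : 0 < y) {G : (ℝ × Ed d) × (ℝ × Ed d) → ℂ}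
    (hG : ContDiffOn ℝ ∞ G {q | 0 < q.1.1}) (h0 : ∀ q, q.1.1 < ε * y → G q = 0) : ContDiff ℝ ∞ G := by
  rw [contDiff_iff_contDiffAt]
  intro q
  by_cases hq : 0 < q.1.1
  · refine hG.contDiffAt (IsOpen.mem_nhds ?_ hq)
    exact isOpen_lt continuous_const (by fun_prop)
  · have hq' : q.1.1 < ε * y := lt_of_le_of_lt (not_lt.mp hq) (by positivity)
    have : G =ᶠ[𝓝 q] fun _ => 0 := by
      have ho : IsOpen {q : (ℝ × Ed d) × (ℝ × Ed d) | q.1.1 < ε * y} :=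
        isOpen_lt (by fun_prop) continuous_const
      filter_upwards [ho.mem_nhds hq'] with r hr using h0 r hr
    exact contDiffAt_const.congr_of_eventuallyEq this

theorem T1_eq {h : ℝ} (σ : (ℝ × Ed d) → (ℝ × Ed d) → (ℝ × Ed d) → (ℝ × Ed d) → ℂ)
    (x ξ : ℝ × Ed d) {α β : ℝ} (hα : 0 < α) (hβ : 0 < β) (hαβ : α * β = h)
    (h0 : ∀ x₁ ξ₁, x₁.1 ≤ 0 → σ x ξ x₁ ξ₁ = 0) :
    T1 d h σ x ξ = (((2 * π) ^ (d + 1) : ℝ) : ℂ)⁻¹ *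
      II ((fun q => σ x ξ q.1 q.2) ∘ AA x ξ α β) := by
  unfold T1
  rw [setIntegral_eq_integral_of_forall_compl_eq_zero]
  swap
  · intro u hu
    have : u.1 ≤ 0 := by
      by_contra hc
      exact hu ⟨not_le.mp hc, trivial⟩
    simp [h0 u _ this]
  rw [cov x hα]
  simp_rw [cov (d := d) (F := fun ξ₁ => Complex.exp (Complex.I * Complex.ofReal
    (epair d (_ - x) (ξ₁ - ξ) / h)) * σ x ξ _ ξ₁) ξ hβ]
  rw [integral_const_mul]
  have e1 : ∀ w z : Ed (d + 1), epair d (x + α • Phi w - x) (ξ + β • Phi z - ξ) / h = ⟪w, z⟫ := by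
    intro w z
    rw [add_sub_cancel_left, add_sub_cancel_left, ← map_smul, ← map_smul, epair_Phi,
      inner_smul_left, inner_smul_right, ← hαβ]
    simp only [conj_trivial]
    field_simp
  simp_rw [e1]
  have e2 : (∫ w : Ed (d + 1), ∫ z : Ed (d + 1), Complex.exp (Complex.I * ((⟪w, z⟫ : ℝ) : ℂ)) *
      σ x ξ (x + α • Phi w) (ξ + β • Phi z)) = II ((fun q => σ x ξ q.1 q.2) ∘ AA x ξ α β) := rfl
  rw [e2, Complex.real_smul, ← mul_assoc, ← mul_assoc]
  congr 1
  rw [← Complex.ofReal_mul, ← Complex.ofReal_mul, ← Complex.ofReal_inv]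
  congr 1
  rw [← hαβ, mul_pow, mul_pow α β]
  field_simp

end Grad


section Final
variable {d : ℕ}

/-- The weight. -/
def Wt (k₀ k₁ y β : ℝ) (ξ : ℝ × Ed d) (z : Ed (d + 1)) : ℝ :=
  (1 + y * xiNorm d ξ) ^ k₀ * (1 + y * xiNorm d (ξ + β • Phi z)) ^ k₁

theorem xiNorm_nonneg (ξ : ℝ × Ed d) : 0 ≤ xiNorm d ξ := Real.sqrt_nonneg _

theorem Wt_nonneg {k₀ k₁ y β : ℝ} (hy : 0 < y) (ξ : ℝ × Ed d) (z : Ed (d + 1)) :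
    0 ≤ Wt k₀ k₁ y β ξ z := by
  have h1 := xiNorm_nonneg ξ
  have h2 := xiNorm_nonneg (ξ + β • Phi z)
  unfold Wt; positivity

theorem Wt_zero {k₀ k₁ y β : ℝ} (hy : 0 < y) (ξ : ℝ × Ed d) :
    Wt k₀ k₁ y β ξ 0 = (1 + y * xiNorm d ξ) ^ (k₀ + k₁) := by
  have h1 := xiNorm_nonneg ξ
  rw [Real.rpow_add (by positivity), Wt]; simp

theorem Wt_int {k₀ k₁ y β : ℝ} (hk : k₁ < -((d : ℝ) + 1)) (hy : 0 < y) (hβ : 0 < β) (ξ : ℝ × Ed d) :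
    Integrable (Wt k₀ k₁ y β ξ) := by
  obtain ⟨ζ, rfl⟩ := Phi_surj ξ
  have h1 : Integrable (fun u : Ed (d + 1) => (1 + ‖u‖) ^ (-(-k₁))) :=
    integrable_one_add_norm (by simp; linarith)
  have h2 := h1.comp_add_left (y • ζ)
  have h3 := (h2.comp_smul (R := y * β) (by positivity)).const_mul ((1 + y * xiNorm d (Phi ζ)) ^ k₀)
  refine h3.congr (Eventually.of_forall fun z => ?_)
  simp only [Wt, neg_neg]
  rw [← map_smul, ← map_add, xiNorm_Phi, xiNorm_Phi, mul_smul, ← smul_add, norm_smul,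
    Real.norm_of_nonneg hy.le]

theorem Wt_peetre {k₀ k₁ y β : ℝ} (hk : k₁ ≤ 0) (hy : 0 < y) (hβ : 0 < β) (hyβ : y * β ≤ 1)
    (ξ : ℝ × Ed d) (z : Ed (d + 1)) :
    Wt k₀ k₁ y β ξ z ≤ 2 ^ ⌈-k₁⌉₊ * Wt k₀ k₁ y β ξ 0 * (1 + ‖z‖ ^ 2) ^ ⌈-k₁⌉₊ := by
  obtain ⟨ζ, rfl⟩ := Phi_surj ξ
  simp only [Wt, map_zero, smul_zero, add_zero]
  rw [← map_smul, ← map_add, xiNorm_Phi, xiNorm_Phi]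
  set K := ⌈-k₁⌉₊
  have hK : -k₁ ≤ K := Nat.le_ceil _
  have a1 : ‖ζ‖ ≤ ‖ζ + β • z‖ + β * ‖z‖ := by
    have := norm_sub_le (ζ + β • z) (β • z)
    rw [add_sub_cancel_right, norm_smul, Real.norm_of_nonneg hβ.le] at this
    exact this
  have hz := norm_nonneg z
  have hζ := norm_nonneg ζ
  have hζ' := norm_nonneg (ζ + β • z)
  have a2 : 1 + y * ‖ζ‖ ≤ (1 + y * ‖ζ + β • z‖) * (1 + ‖z‖) := by
    have b1 : y * ‖ζ‖ ≤ y * ‖ζ + β • z‖ + (y * β) * ‖z‖ := by nlinarith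
    have b2 : (y * β) * ‖z‖ ≤ 1 * ‖z‖ := mul_le_mul_of_nonneg_right hyβ hz
    have b3 : 0 ≤ y * ‖ζ + β • z‖ * ‖z‖ := by positivity
    nlinarith
  have a3 : (1 + y * ‖ζ + β • z‖) ^ k₁ * (1 + ‖z‖) ^ k₁ ≤ (1 + y * ‖ζ‖) ^ k₁ := by
    rw [← Real.mul_rpow (by positivity) (by positivity)]
    exact Real.rpow_le_rpow_of_nonpos (by positivity) a2 hk
  have a4 : (1 + ‖z‖) ^ (-k₁) ≤ 2 ^ K * (1 + ‖z‖ ^ 2) ^ K := by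
    calc (1 + ‖z‖) ^ (-k₁) ≤ (1 + ‖z‖) ^ (K : ℝ) := Real.rpow_le_rpow_of_exponent_le (by linarith) hK
      _ = (1 + ‖z‖) ^ K := Real.rpow_natCast _ _
      _ ≤ (2 * (1 + ‖z‖ ^ 2)) ^ K := by
          refine pow_le_pow_left₀ (by positivity) ?_ _
          nlinarith [sq_nonneg (‖z‖ - 1)]
      _ = _ := mul_pow _ _ _
  have a5 : (1 + ‖z‖) ^ k₁ * (1 + ‖z‖) ^ (-k₁) = 1 := by
    rw [← Real.rpow_add (by positivity)]; simp
  have p1 : 0 ≤ (1 + y * ‖ζ‖) ^ k₀ := by positivity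
  have p2 : 0 ≤ (1 + y * ‖ζ‖) ^ k₁ := by positivity
  have p3 : 0 ≤ (1 + ‖z‖) ^ (-k₁) := by positivity
  calc (1 + y * ‖ζ‖) ^ k₀ * (1 + y * ‖ζ + β • z‖) ^ k₁
      = (1 + y * ‖ζ‖) ^ k₀ * (((1 + y * ‖ζ + β • z‖) ^ k₁ * (1 + ‖z‖) ^ k₁) * (1 + ‖z‖) ^ (-k₁)) := by
        rw [mul_assoc ((1 + y * ‖ζ + β • z‖) ^ k₁), a5, mul_one]
    _ ≤ (1 + y * ‖ζ‖) ^ k₀ * ((1 + y * ‖ζ‖) ^ k₁ * (2 ^ K * (1 + ‖z‖ ^ 2) ^ K)) :=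
        mul_le_mul_of_nonneg_left (mul_le_mul a3 a4 p3 p2) p1
    _ = _ := by ring

theorem scale_id {h y ρ : ℝ} (hh : 0 < h) (hy : 0 < y) (a c : ℕ) :
    (y * √h) ^ a * (√h / y) ^ c * (h ^ (-(ρ * ((a : ℝ) + (c : ℝ)))) * y ^ ((c : ℝ) - (a : ℝ))) =
      (h ^ (1 / 2 - ρ)) ^ (c + a) := by
  have e1 : √h = h ^ (1 / 2 : ℝ) := Real.sqrt_eq_rpow h
  have e2 : y ^ ((c : ℝ) - (a : ℝ)) = y ^ c / y ^ a := by
    rw [Real.rpow_sub hy, Real.rpow_natCast, Real.rpow_natCast]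
  have e3 : h ^ (1 / 2 - ρ) = √h * h ^ (-ρ) := by
    rw [e1, ← Real.rpow_add hh]; rfl
  have e4 : h ^ (-(ρ * ((a : ℝ) + (c : ℝ)))) = (h ^ (-ρ)) ^ (c + a) := by
    rw [← Real.rpow_natCast, ← Real.rpow_mul hh.le]; congr 1; push_cast; ring
  rw [e2, e3, e4, mul_pow, mul_pow, div_pow, pow_add (√h)]
  field_simp

theorem symbol_bd {ε ρ k₀ k₁ : ℝ} (hε : 0 < ε)
    {c₀ : ℕ → ℕ → ℝ} (hc₀ : ∀ a c, 0 < c₀ a c) (l : List (Fin (d + 1) ⊕ Fin (d + 1))) :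
    ∃ C : ℝ, 0 ≤ C ∧ ∀ (h y : ℝ) (x ξ : ℝ × Ed d) (G : (ℝ × Ed d) × (ℝ × Ed d) → ℂ),
      0 < h → x.1 = y → 0 < y → ContDiff ℝ ∞ G → (∀ q, q.1.1 < ε * y → G q = 0) →
      (∀ a c : ℕ, ∀ x₁ ξ₁ : ℝ × Ed d, 0 < x₁.1 →
        ‖iteratedFDeriv ℝ a (fun w => iteratedFDeriv ℝ c (fun z => G (w, z)) ξ₁) x₁‖ ≤
          c₀ a c * h ^ (-(ρ * ((a : ℝ) + (c : ℝ)))) * y ^ ((c : ℝ) - (a : ℝ)) *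
            (1 + y * xiNorm d ξ) ^ k₀ * (1 + y * xiNorm d ξ₁) ^ (k₁ - (c : ℝ))) →
      ∀ q, ‖ddl dv l (G ∘ AA x ξ (y * √h) (√h / y)) q‖ ≤
        C * ((h ^ (1 / 2 - ρ)) ^ l.length * Wt k₀ k₁ y (√h / y) ξ q.2) := by
  obtain ⟨lr, ll, hl⟩ := split_list l
  refine ⟨c₀ ll.length lr.length, (hc₀ _ _).le, ?_⟩
  intro h y x ξ G hh hxy hy hG h0 hb q
  have hsh : 0 < √h := Real.sqrt_pos.mpr hh
  have hW := Wt_nonneg (k₀ := k₀) (k₁ := k₁) (β := √h / y) hy ξ q.2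
  have hδ : 0 ≤ h ^ (1 / 2 - ρ) := by positivity
  have hC := hc₀ ll.length lr.length
  rw [ddl_comp (AA_smooth x ξ _ _) (AA_deriv x ξ _ _) (AA'_dv _ _) l hG]
  simp only [Pi.smul_apply, Function.comp_apply, smul_eq_mul, norm_mul, Complex.norm_real]
  have e1 : (l.map (Sum.elim (fun _ => y * √h) (fun _ => √h / y))).prod =
      (y * √h) ^ ll.length * (√h / y) ^ lr.length := by
    rw [(hl.map _).prod_eq]
    simp [Function.comp_def, List.map_const', mul_comm]
  have e2 : l.length = lr.length + ll.length := by
    rw [hl.length_eq]; simp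
  rw [e1, Real.norm_of_nonneg (by positivity), e2]
  set X := AA x ξ (y * √h) (√h / y) q with hX
  by_cases hp : X.1.1 < ε * y
  · have ho : IsOpen {q : (ℝ × Ed d) × (ℝ × Ed d) | q.1.1 < ε * y} :=
      isOpen_lt (by fun_prop) continuous_const
    rw [ddl_eq_zero (v2 hv) ho l (f := G) (fun q hq => h0 q hq) X hp]
    simp only [norm_zero, mul_zero]
    positivity
  · have hp' : 0 < X.1.1 := lt_of_lt_of_le (by positivity) (not_lt.mp hp)
    have f1 := ddl_le_iter hv hv_norm lr ll hG X
    rw [← ddl_perm (v2 hv) hl hG] at f1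
    have f2 := f1.trans (hb ll.length lr.length X.1 X.2 hp')
    have n1 := xiNorm_nonneg ξ
    have n2 := xiNorm_nonneg X.2
    have f3 : (1 + y * xiNorm d X.2) ^ (k₁ - (lr.length : ℝ)) ≤ (1 + y * xiNorm d X.2) ^ k₁ := by
      refine Real.rpow_le_rpow_of_exponent_le ?_ ?_
      · have : 0 ≤ y * xiNorm d X.2 := by positivity
        linarith
      · have : (0 : ℝ) ≤ lr.length := Nat.cast_nonneg _
        linarith
    have f4 : Wt k₀ k₁ y (√h / y) ξ q.2 = (1 + y * xiNorm d ξ) ^ k₀ * (1 + y * xiNorm d X.2) ^ k₁ := rfl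
    rw [f4, ← scale_id (ρ := ρ) hh hy ll.length lr.length]
    have p1 : 0 ≤ (y * √h) ^ ll.length * (√h / y) ^ lr.length := by positivity
    calc _ ≤ (y * √h) ^ ll.length * (√h / y) ^ lr.length *
          (c₀ ll.length lr.length * h ^ (-(ρ * ((ll.length : ℝ) + (lr.length : ℝ)))) *
            y ^ ((lr.length : ℝ) - (ll.length : ℝ)) *
            (1 + y * xiNorm d ξ) ^ k₀ * (1 + y * xiNorm d X.2) ^ k₁) := by
          refine mul_le_mul_of_nonneg_left (f2.trans ?_) p1
          exact mul_le_mul_of_nonneg_left f3 (by positivity)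
      _ = _ := by ring

end Final

/-- **Stationary phase expansion for `T₁`.** For a `(1,ρ)`-symbol `σ` of
order `(k₀,k₁)`, `k₁ < -(d+1)`, supported in `{ε ≤ y₁/y ≤ 1/ε}`, one has for every `n`
`|T₁σ(x,ξ,h) - Σ_{s≤n} ((ih)^s/s!) (∇_{x₁}·∇_{ξ₁})^s σ(x,ξ;x₁,ξ₁)|_{(x₁,ξ₁)=(x,ξ)}|
≤ C_n h^{(n+1)(1-2ρ)} (1+y|ξ|)^{k₀+k₁}`. -/
theorem stmt7 (d : ℕ) (hd : 1 ≤ d) (ε : ℝ) (hε : 0 < ε) (ρ : ℝ) (hρ0 : 0 ≤ ρ)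
    (hρ : ρ < 1 / 2) (k₀ k₁ : ℝ) (hk₁ : k₁ < -((d : ℝ) + 1))
    (σ : ℝ → (ℝ × Ed d) → (ℝ × Ed d) → (ℝ × Ed d) → (ℝ × Ed d) → ℂ)
    (hsupp : ∀ h : ℝ, 0 < h → h ≤ 1 → ∀ x ξ x₁ ξ₁ : ℝ × Ed d, σ h x ξ x₁ ξ₁ ≠ 0 →
      0 < x.1 ∧ ε * x.1 ≤ x₁.1 ∧ x₁.1 ≤ x.1 / ε)
    (hsmooth : ∀ h : ℝ, 0 < h → h ≤ 1 →
      ContDiffOn ℝ (⊤ : ℕ∞)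
        (fun p : (ℝ × Ed d) × (ℝ × Ed d) × (ℝ × Ed d) × (ℝ × Ed d) =>
          σ h p.1 p.2.1 p.2.2.1 p.2.2.2)
        {p : (ℝ × Ed d) × (ℝ × Ed d) × (ℝ × Ed d) × (ℝ × Ed d) | 0 < p.1.1 ∧ 0 < p.2.2.1.1})
    (hbounds : ∀ b₀ c₀ b₁ c₁ : ℕ, ∃ C : ℝ, 0 < C ∧
      ∀ h : ℝ, 0 < h → h ≤ 1 → ∀ x ξ x₁ ξ₁ : ℝ × Ed d, 0 < x.1 → 0 < x₁.1 →
        ‖iteratedFDeriv ℝ b₀ (fun u : ℝ × Ed d =>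
            iteratedFDeriv ℝ c₀ (fun v : ℝ × Ed d =>
              iteratedFDeriv ℝ b₁ (fun w : ℝ × Ed d =>
                iteratedFDeriv ℝ c₁ (fun z : ℝ × Ed d => σ h u v w z) ξ₁) x₁) ξ) x‖ ≤
          C * h ^ (-(ρ * ((b₀ : ℝ) + (b₁ : ℝ) + (c₀ : ℝ) + (c₁ : ℝ)))) *
            x.1 ^ ((c₀ : ℝ) + (c₁ : ℝ) - (b₀ : ℝ) - (b₁ : ℝ)) *
            (1 + x.1 * xiNorm d ξ) ^ (k₀ - (c₀ : ℝ)) *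
            (1 + x.1 * xiNorm d ξ₁) ^ (k₁ - (c₁ : ℝ))) :
    ∀ n : ℕ, ∃ Cn : ℝ, 0 < Cn ∧ ∀ h : ℝ, 0 < h → h ≤ 1 → ∀ x ξ : ℝ × Ed d, 0 < x.1 →
      ‖T1 d h (σ h) x ξ -
          ∑ s ∈ Finset.range (n + 1),
            ((Complex.I * (h : ℂ)) ^ s / (Nat.factorial s : ℂ)) *
              (gradDot d)^[s] (σ h x ξ) x ξ‖ ≤
        Cn * h ^ (((n : ℝ) + 1) * (1 - 2 * ρ)) * (1 + x.1 * xiNorm d ξ) ^ (k₀ + k₁) := by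
  intro n
  let ι := {p : ℝ × (ℝ × Ed d) × (ℝ × Ed d) // 0 < p.1 ∧ p.1 ≤ 1 ∧ 0 < p.2.1.1}
  have hk0 : k₁ ≤ 0 := by
    have : (0 : ℝ) ≤ d := Nat.cast_nonneg _
    linarith
  choose c₀ hc₀ hbd using fun a c : ℕ => hbounds 0 0 a c
  let G : ι → (ℝ × Ed d) × (ℝ × Ed d) → ℂ := fun p q => σ p.1.1 p.1.2.1 p.1.2.2 q.1 q.2
  have hG0 : ∀ (p : ι) q, q.1.1 < ε * p.1.2.1.1 → G p q = 0 := by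
    intro p q hq
    by_contra hne
    have := (hsupp p.1.1 p.2.1 p.2.2.1 _ _ _ _ hne).2.1
    linarith
  have hGs : ∀ p : ι, ContDiff ℝ ∞ (G p) := by
    intro p
    refine smooth_glue hε p.2.2.2 ?_ (hG0 p)
    have h1 := hsmooth p.1.1 p.2.1 p.2.2.1
    refine h1.comp (g := fun p' : (ℝ × Ed d) × (ℝ × Ed d) × (ℝ × Ed d) × (ℝ × Ed d) =>
          σ p.1.1 p'.1 p'.2.1 p'.2.2.1 p'.2.2.2)
      (f := fun q : (ℝ × Ed d) × (ℝ × Ed d) => (p.1.2.1, p.1.2.2, q.1, q.2)) ?_ ?_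
    · exact ContDiff.contDiffOn (by fun_prop)
    · intro q hq
      exact ⟨p.2.2.2, hq⟩
  let δ : ι → ℝ := fun p => p.1.1 ^ (1 / 2 - ρ)
  let M : ι → Ed (d + 1) → ℝ := fun p => Wt k₀ k₁ p.1.2.1.1 (√p.1.1 / p.1.2.1.1) p.1.2.2
  let b : ι → Ed (d + 1) × Ed (d + 1) → ℂ := fun p =>
    G p ∘ AA p.1.2.1 p.1.2.2 (p.1.2.1.1 * √p.1.1) (√p.1.1 / p.1.2.1.1)
  have hsq : ∀ p : ι, 0 < √p.1.1 := fun p => Real.sqrt_pos.mpr p.2.1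
  have hβ : ∀ p : ι, 0 < √p.1.1 / p.1.2.1.1 := fun p => div_pos (hsq p) p.2.2.2
  have hα : ∀ p : ι, 0 < p.1.2.1.1 * √p.1.1 := fun p => mul_pos p.2.2.2 (hsq p)
  obtain ⟨C, hC, H⟩ := main_abs (M := M) (b := b) δ (fun p => Real.rpow_nonneg p.2.1.le _)
    (fun p => Real.rpow_le_one p.2.1.le p.2.2.1 (by linarith))
    (fun p => Wt_int hk₁ p.2.2.2 (hβ p) _) (fun p z => Wt_nonneg p.2.2.2 _ z)
    (2 ^ ⌈-k₁⌉₊) (by positivity) ⌈-k₁⌉₊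
    (fun p z => Wt_peetre hk0 p.2.2.2 (hβ p) (by
      rw [mul_div_cancel₀ _ p.2.2.2.ne']
      exact Real.sqrt_le_one.mpr p.2.2.1) _ z)
    (fun p => (hGs p).comp (AA_smooth _ _ _ _))
    (fun l => by
      obtain ⟨C, hC, H⟩ := symbol_bd (d := d) (ε := ε) (ρ := ρ) (k₀ := k₀) (k₁ := k₁) hε hc₀ l
      refine ⟨C, hC, fun p q => H p.1.1 p.1.2.1.1 p.1.2.1 p.1.2.2 (G p) p.2.1 rfl p.2.2.2 (hGs p)
        (hG0 p) (fun a c x₁ ξ₁ hx₁ => ?_) q⟩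
      have := hbd a c p.1.1 p.2.1 p.2.2.1 p.1.2.1 p.1.2.2 x₁ ξ₁ p.2.2.2 hx₁
      rw [norm_iteratedFDeriv_zero, norm_iteratedFDeriv_zero] at this
      simpa using this) (n + 1)
  refine ⟨C + 1, by positivity, ?_⟩
  intro h hh hh1 x ξ hx
  let p : ι := ⟨(h, x, ξ), hh, hh1, hx⟩
  have Hp := H p
  have hαβ : (x.1 * √h) * (√h / x.1) = h := by
    rw [show (x.1 * √h) * (√h / x.1) = (√h * √h) * (x.1 / x.1) by ring, div_self hx.ne',
      Real.mul_self_sqrt hh.le, mul_one]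
  have hT := T1_eq (σ := σ h) (x := x) (ξ := ξ) (hα p) (hβ p) hαβ (fun x₁ ξ₁ hx₁ =>
    hG0 p (x₁, ξ₁) (lt_of_le_of_lt hx₁ (mul_pos hε hx)))
  have hS : ∀ s : ℕ, (Complex.I * (h : ℂ)) ^ s / (Nat.factorial s : ℂ) * (gradDot d)^[s] (σ h x ξ) x ξ =
      Complex.I ^ s / (Nat.factorial s : ℂ) * (LL^[s] (b p) 0) := by
    intro s
    have g1 : (gradDot d)^[s] (σ h x ξ) = fun w z => LH^[s] (G p) (w, z) := gradDot_iter s (hGs p)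
    have g2 : LL^[s] (b p) = _ := LL_iter_comp x ξ (x.1 * √h) (√h / x.1) s (hGs p)
    rw [g1, g2, hαβ]
    have g3 : AA x ξ (x.1 * √h) (√h / x.1) 0 = (x, ξ) := by simp [AA]
    rw [Pi.smul_apply, Function.comp_apply, g3, mul_pow, smul_eq_mul]
    ring
  rw [hT, Finset.sum_congr rfl fun s _ => hS s]
  refine Hp.trans ?_
  have q1 : δ p ^ (2 * (n + 1)) = h ^ (((n : ℝ) + 1) * (1 - 2 * ρ)) := by
    show (h ^ (1 / 2 - ρ)) ^ (2 * (n + 1)) = _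
    rw [← Real.rpow_natCast, ← Real.rpow_mul hh.le]
    congr 1; push_cast; ring
  have q2 : M p 0 = (1 + x.1 * xiNorm d ξ) ^ (k₀ + k₁) := Wt_zero hx ξ
  rw [q1, q2, mul_assoc]
  have n1 := xiNorm_nonneg ξ
  refine mul_le_mul_of_nonneg_right (by linarith) ?_
  positivity
end
end

section
/- (The quantization has the right principal symbol.) Let σ : ℍ^{d+1} × ℝ^{d+1} → ℂ be smooth, Λ-periodic in θ, and satisfy: for all multi-indices α (in ξ), β (in x) and every M ≥ 0 there is C with |∂_x^β ∂_ξ^α σ(x,ξ)| ≤ C y^{|β|−|α|} (1 + y|ξ|)^{-M}. Let x₀ ∈ Z_Λ, ξ₀ ∈ ℝ^{d+1}, let φ be a smooth real-valued function on Z_Λ with φ(x₀) = 0 and dφ(x₀) = ξ₀ (in the coordinates (y,θ)), and let χ ∈ C_c^∞(Z_Λ) be equal to 1 on a neighbourhood of x₀. Then lim_{h→0⁺} Op_h(σ)(χ e^{iφ/h})(x₀) = σ(x₀, ξ₀). -/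
open MeasureTheory Real Filter
open scoped RealInnerProductSpace ENNReal NNReal Topology

noncomputable section

/-- The semiclassical Weyl kernel `K^w_σ(x,x') = (2πh)^{-(d+1)} ∫ e^{i⟨x-x',ξ⟩/h} σ((x+x')/2, ξ) dξ`
on the half-space `ℍ^{d+1}`. -/
def weylKernel (d : ℕ) (h : ℝ) (σ : (ℝ × Ed d) → (ℝ × Ed d) → ℂ) (x x' : ℝ × Ed d) : ℂ :=
  ((2 * π * h) ^ (d + 1))⁻¹ •
    ∫ ξ : ℝ × Ed d,
      Complex.exp (Complex.I * Complex.ofReal (epair d (x - x') ξ / h)) *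
        σ ((1 / 2 : ℝ) • (x + x')) ξ

/-- The kernel `K_σ(x,x') = (y/y')^{(d+1)/2} ∑_{k∈Λ} K^w_σ(y,θ,y',θ'+k)` of the cusp
quantization, with respect to the Lebesgue measure `dy' dθ'` on the half-cylinder. -/
def cuspKernel (d : ℕ) (Λ : AddSubgroup (Ed d)) (h : ℝ) (σ : (ℝ × Ed d) → (ℝ × Ed d) → ℂ)
    (x x' : ℝ × Ed d) : ℂ :=
  ((x.1 / x'.1) ^ (((d : ℝ) + 1) / 2)) • ∑' k : Λ, weylKernel d h σ x (x'.1, x'.2 + (k : Ed d))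

/-- The cusp quantization `Op_h(σ)` as an integral operator on `Z_Λ`. -/
def cuspOp (d : ℕ) (Λ : AddSubgroup (Ed d)) (D : Set (Ed d)) (h : ℝ)
    (σ : (ℝ × Ed d) → (ℝ × Ed d) → ℂ) (f : ℝ × Ed d → ℂ) (x : ℝ × Ed d) : ℂ :=
  ∫ x' in cusp d D, cuspKernel d Λ h σ x x' * f x'


instance instHaarProdEd (d : ℕ) : Measure.IsAddHaarMeasure (volume : Measure (ℝ × Ed d)) :=
  inferInstanceAs (Measure.IsAddHaarMeasure ((volume : Measure ℝ).prod (volume : Measure (Ed d))))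

/-- The (unnormalised) Fourier integral on `ℝ × ℝᵈ`. -/
def GT (d : ℕ) (f : ℝ × Ed d → ℂ) (z : ℝ × Ed d) : ℂ :=
  ∫ ξ : ℝ × Ed d, Complex.exp (Complex.I * Complex.ofReal (epair d z ξ)) * f ξ

/-- `epair` as a continuous bilinear map. -/
def epairL (d : ℕ) : (ℝ × Ed d) →L[ℝ] (ℝ × Ed d) →L[ℝ] ℝ :=
  (ContinuousLinearMap.mul ℝ ℝ).bilinearComp (ContinuousLinearMap.fst ℝ ℝ (Ed d))
      (ContinuousLinearMap.fst ℝ ℝ (Ed d)) +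
    (show Ed d →L[ℝ] Ed d →L[ℝ] ℝ from innerSL ℝ).bilinearComp (ContinuousLinearMap.snd ℝ ℝ (Ed d))
      (ContinuousLinearMap.snd ℝ ℝ (Ed d))

lemma epairL_apply (d : ℕ) (x ξ : ℝ × Ed d) : epairL d x ξ = epair d x ξ := by
  simp [epairL, epair]
  rfl

lemma epair_comm (d : ℕ) (x ξ : ℝ × Ed d) : epair d x ξ = epair d ξ x := by
  simp [epair, real_inner_comm, mul_comm]

lemma epair_smul_left (d : ℕ) (c : ℝ) (x ξ : ℝ × Ed d) : epair d (c • x) ξ = c * epair d x ξ := by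
  simp [← epairL_apply]

lemma continuous_epair (d : ℕ) : Continuous (fun p : (ℝ × Ed d) × (ℝ × Ed d) => epair d p.1 p.2) := by
  unfold epair
  fun_prop

lemma norm_sq_le_epair (d : ℕ) (z : ℝ × Ed d) : ‖z‖ ^ 2 ≤ epair d z z := by
  have h1 : epair d z z = z.1 ^ 2 + ‖z.2‖ ^ 2 := by
    simp [epair, sq]
  rw [h1, Prod.norm_def]
  rcases max_cases ‖z.1‖ ‖z.2‖ with ⟨h, _⟩ | ⟨h, _⟩ <;> rw [h]
  · rw [Real.norm_eq_abs, sq_abs]; nlinarith [sq_nonneg ‖z.2‖]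
  · nlinarith [sq_nonneg z.1]

lemma norm_le_xiNorm (d : ℕ) (z : ℝ × Ed d) : ‖z‖ ≤ xiNorm d z := by
  unfold xiNorm
  apply Real.le_sqrt_of_sq_le
  refine (norm_sq_le_epair d z).trans (le_of_eq ?_)
  simp [epair, sq]

lemma GT_decay (d : ℕ) (f : ℝ × Ed d → ℂ) (hf : ContDiff ℝ (⊤ : ℕ∞) f)
    (hint : ∀ n : ℕ, Integrable (fun v => ‖iteratedFDeriv ℝ n f v‖)) (n : ℕ) (z : ℝ × Ed d) :
    ‖z‖ ^ n * ‖GT d f z‖ ≤ (4 * π) ^ n *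
      ∑ j ∈ Finset.range (n + 1), ∫ v, ‖iteratedFDeriv ℝ j f v‖ := by
  have key := VectorFourier.pow_mul_norm_iteratedFDeriv_fourierIntegral_le
    (μ := (volume : Measure (ℝ × Ed d))) (K := 0) (N := ⊤) (-(2 * π)⁻¹ • epairL d) hf
    (by
      intro k n hk _
      have : k = 0 := by simpa using hk
      subst this
      simpa using hint n) (k := 0) (n := n) le_rfl le_top z z
  have hG : VectorFourier.fourierIntegral Real.fourierChar (volume : Measure (ℝ × Ed d))
      (-(2 * π)⁻¹ • epairL d).toLinearMap₁₂ f z = GT d f z := by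
    unfold GT VectorFourier.fourierIntegral
    congr 1
    ext ξ
    rw [Circle.smul_def, Real.fourierChar_apply, smul_eq_mul]
    congr 2
    have : (2 * π * -((-(2 * π)⁻¹ • epairL d).toLinearMap₁₂ ξ z) : ℝ) = epair d z ξ := by
      simp [epairL_apply, epair_comm d z ξ]
      field_simp
    rw [this, mul_comm]
  simp only [norm_iteratedFDeriv_zero, hG] at key
  have h2 : |(-(2 * π)⁻¹ • epairL d) z z| = (2 * π)⁻¹ * epair d z z := by
    have h0 : 0 ≤ epair d z z := (sq_nonneg _).trans (norm_sq_le_epair d z)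
    simp [epairL_apply, abs_mul, abs_of_nonneg h0, abs_of_pos pi_pos]
  rw [h2] at key
  simp only [Finset.sum_product, Finset.range_one, Finset.sum_singleton, pow_zero, one_mul,
    zero_add, Nat.cast_zero, mul_zero, mul_one] at key
  set S := ∑ j ∈ Finset.range (n + 1), ∫ v, ‖iteratedFDeriv ℝ j f v‖ with hS
  have hS0 : 0 ≤ S := Finset.sum_nonneg fun j _ => integral_nonneg fun _ => norm_nonneg _
  rcases eq_or_ne z 0 with rfl | hz
  · rcases Nat.eq_zero_or_pos n with rfl | hn
    · simpa using key
    · simp [hn.ne']; positivity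
  · have hz' : 0 < ‖z‖ ^ n := pow_pos (norm_pos_iff.2 hz) n
    have h3 : ((2 * π)⁻¹ * ‖z‖ ^ 2) ^ n * ‖GT d f z‖ ≤ ‖z‖ ^ n * 2 ^ n * S := by
      refine le_trans ?_ key
      gcongr
      exact norm_sq_le_epair d z
    have h4 : ‖z‖ ^ n * (‖z‖ ^ n * ‖GT d f z‖) ≤ ‖z‖ ^ n * ((4 * π) ^ n * S) := by
      calc ‖z‖ ^ n * (‖z‖ ^ n * ‖GT d f z‖)
          = (2 * π) ^ n * (((2 * π)⁻¹ * ‖z‖ ^ 2) ^ n * ‖GT d f z‖) := by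
            rw [← mul_assoc ((2 * π) ^ n), ← mul_pow, ← mul_assoc (‖z‖ ^ n), ← mul_pow]
            congr 2
            field_simp
        _ ≤ (2 * π) ^ n * (‖z‖ ^ n * 2 ^ n * S) := by gcongr
        _ = ‖z‖ ^ n * ((4 * π) ^ n * S) := by
            rw [show (4 * π) = (2 * π) * 2 by ring, mul_pow (2 * π)]; ring
    exact le_of_mul_le_mul_left h4 hz'

lemma GT_inversion (d : ℕ) (f : ℝ × Ed d → ℂ) (hf : Continuous f) (hfi : Integrable f)
    (hGi : Integrable (GT d f)) (ξ₀ : ℝ × Ed d) :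
    ∫ z, Complex.exp (-(Complex.I * Complex.ofReal (epair d z ξ₀))) * GT d f z =
      ((2 * π) ^ (d + 1) : ℝ) • f ξ₀ := by
  let E := WithLp 2 (ℝ × Ed d)
  have hmp : MeasurePreserving (@WithLp.ofLp 2 (ℝ × Ed d)) :=
    WithLp.volume_preserving_ofLp ℝ (Ed d)
  have hme : MeasurableEmbedding (@WithLp.ofLp 2 (ℝ × Ed d)) :=
    (MeasurableEquiv.toLp 2 (ℝ × Ed d)).symm.measurableEmbedding
  let g : E → ℂ := fun v => f v.ofLp
  have hgc : Continuous g := hf.comp (WithLp.prod_continuous_ofLp 2 ℝ (Ed d))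
  have hgi : Integrable g := (hmp.integrable_comp_emb hme).2 hfi
  have hpair : ∀ v w : E, inner ℝ v w = epair d v.ofLp w.ofLp := by
    intro v w
    rw [WithLp.prod_inner_apply]
    simp [epair, mul_comm]
  have hF : ∀ w : E, FourierTransform.fourier g w = GT d f ((-(2 * π)) • w.ofLp) := by
    intro w
    rw [Real.fourier_eq', GT, ← hmp.integral_comp hme]
    congr 1
    ext v
    simp only [smul_eq_mul, g]
    rw [hpair, epair_smul_left, epair_comm d v.ofLp]
    congr 2
    push_cast
    ring
  have hFinv : ∀ w : E, FourierTransformInv.fourierInv g w = GT d f ((2 * π) • w.ofLp) := by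
    intro w
    rw [Real.fourierInv_eq', GT, ← hmp.integral_comp hme]
    congr 1
    ext v
    simp only [smul_eq_mul, g]
    rw [hpair, epair_smul_left, epair_comm d v.ofLp]
    congr 2
    push_cast
    ring
  have hFi : Integrable (FourierTransform.fourier g) := by
    have h1 : Integrable (fun z => GT d f ((-(2 * π)) • z)) :=
      hGi.comp_smul (by simp [pi_ne_zero])
    have := (hmp.integrable_comp_emb hme).2 h1
    refine this.congr (Eventually.of_forall fun w => ?_)
    simp [hF]
  have inv := congrFun (hgc.fourier_fourierInv_eq hgi hFi) (WithLp.toLp 2 ξ₀)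
  rw [Real.fourier_eq'] at inv
  simp only [hFinv] at inv
  have h5 : ∫ z, Complex.exp (-(Complex.I * Complex.ofReal (epair d ((2 * π) • z) ξ₀))) *
      GT d f ((2 * π) • z) = f ξ₀ := by
    rw [← hmp.integral_comp hme]
    refine Eq.trans ?_ inv
    congr 1
    ext v
    rw [hpair, epair_smul_left, smul_eq_mul]
    congr 2
    push_cast
    ring
  have h6 := Measure.integral_comp_smul (volume : Measure (ℝ × Ed d))
    (fun z => Complex.exp (-(Complex.I * Complex.ofReal (epair d z ξ₀))) * GT d f z) (2 * π)
  rw [h5] at h6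
  have hfr : Module.finrank ℝ (ℝ × Ed d) = d + 1 := by simp [add_comm]
  rw [h6, hfr, smul_smul, abs_of_pos (by positivity), mul_inv_cancel₀ (by positivity), one_smul]

open scoped Pointwise in
lemma span_top_of_fd (d : ℕ) (Λ : AddSubgroup (Ed d)) [Countable Λ]
    (D : Set (Ed d)) (hD : IsAddFundamentalDomain Λ D volume) (hDvol : volume D = 1) :
    Submodule.span ℝ (Λ : Set (Ed d)) = ⊤ := by
  by_contra hne
  obtain ⟨f, hf0, hf⟩ := Submodule.exists_le_ker_of_lt_top _ (lt_top_iff_ne_top.2 hne)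
  have hker : ∀ k ∈ Λ, f k = 0 := fun k hk => hf (Submodule.subset_span hk)
  obtain ⟨w, hw⟩ : ∃ w, f w = 1 := by
    obtain ⟨v, hv⟩ : ∃ v, f v ≠ 0 := by
      by_contra hcon
      push Not at hcon
      exact hf0 (LinearMap.ext hcon)
    exact ⟨(f v)⁻¹ • v, by simp [hv]⟩
  have hfm : Measurable f := (LinearMap.continuous_of_finiteDimensional f).measurable
  let S : ℤ → Set (Ed d) := fun n => f ⁻¹' (Set.Ico (n : ℝ) (n + 1))
  have hSm : ∀ n, MeasurableSet (S n) := fun n => hfm measurableSet_Ico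
  have hSinv : ∀ n (g : Λ), (fun x => g +ᵥ x) ⁻¹' (S n) = S n := by
    intro n g
    ext x
    simp [S, AddSubgroup.vadd_def, hker g g.2]
  have hstep : ∀ n, volume (S n ∩ D) = volume (S (n + 1) ∩ D) := by
    intro n
    rw [hD.measure_set_eq (hD.vadd_of_comm w) (hSm (n + 1)) (hSinv (n + 1))]
    have : S (n + 1) ∩ (w +ᵥ D) = w +ᵥ (S n ∩ D) := by
      rw [Set.vadd_set_inter]
      congr 1
      ext x
      rw [Set.mem_vadd_set_iff_neg_vadd_mem]
      simp only [S, Set.mem_preimage, vadd_eq_add, map_add, map_neg, hw, Set.mem_Ico]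
      push_cast
      constructor <;> rintro ⟨h1, h2⟩ <;> constructor <;> linarith
    rw [this, measure_vadd]
  have hconst : ∀ n, volume (S n ∩ D) = volume (S 0 ∩ D) := by
    intro n
    induction n using Int.induction_on with
    | zero => rfl
    | succ n ih => rw [← hstep, ih]
    | pred n ih => rw [hstep]; simpa using ih
  have hun : (⋃ n, S n ∩ D) = D := by
    ext x
    simp only [Set.mem_iUnion, Set.mem_inter_iff]
    refine ⟨fun ⟨_, h⟩ => h.2, fun h => ⟨⌊f x⌋, ⟨Int.floor_le _, Int.lt_floor_add_one _⟩, h⟩⟩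
  have hsum : volume D = ∑' n : ℤ, volume (S n ∩ D) := by
    conv_lhs => rw [← hun]
    refine measure_iUnion₀ ?_ fun n => (hSm n).nullMeasurableSet.inter hD.nullMeasurableSet
    intro m n hmn
    refine Disjoint.aedisjoint (Disjoint.mono Set.inter_subset_left Set.inter_subset_left ?_)
    rw [Set.disjoint_left]
    rintro x ⟨h1, h2⟩ ⟨h3, h4⟩
    apply hmn
    have e1 : ⌊f x⌋ = m := Int.floor_eq_iff.2 ⟨h1, h2⟩
    have e2 : ⌊f x⌋ = n := Int.floor_eq_iff.2 ⟨h3, h4⟩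
    omega
  simp only [hconst] at hsum
  rw [hDvol] at hsum
  rcases eq_or_ne (volume (S 0 ∩ D)) 0 with h0 | h0
  · simp [h0] at hsum
  · rw [ENNReal.tsum_const_eq_top_of_ne_zero h0] at hsum
    simp at hsum

lemma chi_bounded (d : ℕ) (Λ : AddSubgroup (Ed d)) [DiscreteTopology Λ] [Countable Λ]
    (D : Set (Ed d)) (hD : IsAddFundamentalDomain Λ D volume) (hDvol : volume D = 1)
    (χ : ℝ × Ed d → ℝ) (hχreg : Continuous χ)
    (hχper : ∀ k ∈ Λ, ∀ x : ℝ × Ed d, χ (x.1, x.2 + k) = χ x)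
    (c₁ c₂ : ℝ) (hχsupp : ∀ x : ℝ × Ed d, x.1 < c₁ ∨ c₂ < x.1 → χ x = 0) :
    ∃ B : ℝ, 0 ≤ B ∧ ∀ x, |χ x| ≤ B := by
  let L : Submodule ℤ (Ed d) := AddSubgroup.toIntSubmodule Λ
  have : DiscreteTopology L := ‹DiscreteTopology Λ›
  have : IsZLattice ℝ L := ⟨span_top_of_fd d Λ D hD hDvol⟩
  have := ZLattice.module_free ℝ L
  let b := Module.Free.chooseBasis ℤ L
  let P : Set (Ed d) := (b.ofZLatticeBasis ℝ).parallelepiped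
  have hP : IsCompact P := (b.ofZLatticeBasis ℝ).parallelepiped.isCompact
  have hred : ∀ θ : Ed d, ∃ k ∈ Λ, θ + k ∈ P := by
    intro x
    let x' : L := b.repr.symm (Finsupp.equivFunOnFinite.symm
      fun i ↦ ⌊(b.ofZLatticeBasis ℝ).repr x i⌋)
    refine ⟨-x', (-x').2, ?_⟩
    simp [P, parallelepiped_basis_eq, x', Int.floor_le, Int.lt_floor_add_one, le_of_lt,
      add_comm (1 : ℝ)]
  obtain ⟨B, hB⟩ := ((isCompact_Icc (a := c₁) (b := c₂)).prod hP).exists_bound_of_continuousOn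
    hχreg.continuousOn
  refine ⟨max B 0, le_max_right _ _, fun x => ?_⟩
  by_cases hx : x.1 < c₁ ∨ c₂ < x.1
  · simp [hχsupp x hx]
  · push Not at hx
    obtain ⟨k, hk, hkP⟩ := hred x.2
    rw [← hχper k hk x]
    exact (hB (x.1, x.2 + k) ⟨⟨hx.1, hx.2⟩, hkP⟩).trans (le_max_left _ _)

open scoped Pointwise in
lemma unfold_integral (d : ℕ) (Λ : AddSubgroup (Ed d)) [Countable Λ]
    (D : Set (Ed d)) (hD : IsAddFundamentalDomain Λ D volume)
    (F : ℝ × Ed d → ℂ) (hF : IntegrableOn F {x : ℝ × Ed d | 0 < x.1}) :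
    ∫ x in cusp d D, ∑' k : Λ, F (x.1, x.2 + (k : Ed d)) = ∫ x in {x : ℝ × Ed d | 0 < x.1}, F x := by
  let _ : AddAction Λ (ℝ × Ed d) :=
    { vadd := fun k x => (x.1, x.2 + (k : Ed d))
      zero_vadd := fun x => by
        change (x.1, x.2 + ((0 : Λ) : Ed d)) = x
        simp
      add_vadd := fun k l x => by
        change (x.1, x.2 + ((k + l : Λ) : Ed d)) = (x.1, (x.2 + (l : Ed d)) + (k : Ed d))
        simp [add_assoc, add_comm, add_left_comm] }
  have hv : ∀ (k : Λ) (x : ℝ × Ed d), k +ᵥ x = (x.1, x.2 + (k : Ed d)) := fun _ _ => rfl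
  let μ : Measure (ℝ × Ed d) := volume.restrict {x : ℝ × Ed d | 0 < x.1}
  have hμ : μ = (volume.restrict (Set.Ioi (0 : ℝ))).prod (volume : Measure (Ed d)) := by
    have : {x : ℝ × Ed d | 0 < x.1} = Set.Ioi (0 : ℝ) ×ˢ (Set.univ : Set (Ed d)) := by
      ext x; simp
    simp only [μ]
    rw [this, Measure.volume_eq_prod, ← Measure.prod_restrict, Measure.restrict_univ]
  have : MeasurableConstVAdd Λ (ℝ × Ed d) := ⟨fun k => by
    change Measurable fun x : ℝ × Ed d => (x.1, x.2 + (k : Ed d))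
    fun_prop⟩
  have : VAddInvariantMeasure Λ (ℝ × Ed d) μ := by
    refine ⟨fun k s hs => ?_⟩
    have : MeasurePreserving (fun x : ℝ × Ed d => (x.1, x.2 + (k : Ed d))) μ μ := by
      rw [hμ]
      exact (MeasurePreserving.id _).prod (measurePreserving_add_right _ _)
    exact this.measure_preimage hs.nullMeasurableSet
  have hfd : IsAddFundamentalDomain Λ ((Set.univ : Set ℝ) ×ˢ D) μ := by
    refine ⟨?_, ?_, ?_⟩
    · rw [hμ]
      exact nullMeasurableSet_univ.prod hD.nullMeasurableSet
    · rw [hμ]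
      have h1 := (Measure.quasiMeasurePreserving_snd (μ := volume.restrict (Set.Ioi (0 : ℝ)))
        (ν := (volume : Measure (Ed d)))).ae hD.ae_covers
      filter_upwards [h1] with x ⟨g, hg⟩
      refine ⟨g, Set.mem_univ _, ?_⟩
      rw [hv]
      simpa [AddSubgroup.vadd_def, add_comm] using hg
    · intro k l hkl
      have h1 : volume ((k +ᵥ D) ∩ (l +ᵥ D)) = 0 := hD.aedisjoint hkl
      have h2 := (Measure.quasiMeasurePreserving_snd (μ := volume.restrict (Set.Ioi (0 : ℝ)))
        (ν := (volume : Measure (Ed d)))).preimage_null h1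
      change μ _ = 0
      rw [hμ]
      refine measure_mono_null ?_ h2
      rintro x ⟨⟨a, ha, rfl⟩, ⟨b, hb, hab⟩⟩
      simp only [hv] at hab ⊢
      refine ⟨⟨a.2, ha.2, ?_⟩, ⟨b.2, hb.2, ?_⟩⟩
      · simp [AddSubgroup.vadd_def, add_comm]
      · have := congrArg Prod.snd hab
        simpa [AddSubgroup.vadd_def, add_comm] using this
  have hres : volume.restrict (cusp d D) = μ.restrict ((Set.univ : Set ℝ) ×ˢ D) := by
    rw [hμ, ← Measure.prod_restrict, Measure.restrict_univ, cusp, Measure.volume_eq_prod,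
      ← Measure.prod_restrict]
  have hFμ : Integrable F μ := hF
  have e1 := hfd.integral_eq_tsum'' F hFμ
  rw [hres]
  refine Eq.trans ?_ e1.symm
  refine integral_tsum (fun k => ?_) ?_
  · exact ((measurePreserving_vadd k μ).integrable_comp_of_integrable hFμ).aestronglyMeasurable.restrict
  · have e2 := hfd.lintegral_eq_tsum'' (fun x => ‖F x‖ₑ)
    change ∑' k : Λ, ∫⁻ x in (Set.univ : Set ℝ) ×ˢ D, ‖F (k +ᵥ x)‖ₑ ∂μ ≠ ⊤
    rw [← e2]
    exact hFμ.2.ne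

lemma sym_bound (d : ℕ) (σ : (ℝ × Ed d) → (ℝ × Ed d) → ℂ)
    (hbounds : ∀ (bx bξ : ℕ) (M : ℝ), ∃ C : ℝ, 0 < C ∧
      ∀ x : ℝ × Ed d, 0 < x.1 → ∀ ξ : ℝ × Ed d,
        ‖iteratedFDeriv ℝ bx
            (fun u : ℝ × Ed d => iteratedFDeriv ℝ bξ (fun v : ℝ × Ed d => σ u v) ξ) x‖ ≤
          C * x.1 ^ ((bx : ℝ) - (bξ : ℝ)) * (1 + x.1 * xiNorm d ξ) ^ (-M))
    (a : ℝ) (ha : 0 < a) (j : ℕ) :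
    ∃ K : ℝ, 0 ≤ K ∧ ∀ u : ℝ × Ed d, a ≤ u.1 → ∀ ξ : ℝ × Ed d,
      ‖iteratedFDeriv ℝ j (σ u) ξ‖ ≤ K * (1 + ‖ξ‖) ^ (-((d : ℝ) + 2)) := by
  obtain ⟨C, hC, hb⟩ := hbounds 0 j ((d : ℝ) + 2)
  set c := min 1 a with hc
  have hc0 : 0 < c := lt_min one_pos ha
  refine ⟨C * a ^ (-(j : ℝ)) * c ^ (-((d : ℝ) + 2)), by positivity, fun u hu ξ => ?_⟩
  have h1 := hb u (ha.trans_le hu) ξ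
  rw [norm_iteratedFDeriv_zero] at h1
  refine h1.trans ?_
  have e1 : u.1 ^ (((0 : ℕ) : ℝ) - (j : ℝ)) ≤ a ^ (-(j : ℝ)) := by
    simp only [Nat.cast_zero, zero_sub]
    exact Real.rpow_le_rpow_of_nonpos ha hu (by simp)
  have e2 : (1 + u.1 * xiNorm d ξ) ^ (-((d : ℝ) + 2)) ≤
      c ^ (-((d : ℝ) + 2)) * (1 + ‖ξ‖) ^ (-((d : ℝ) + 2)) := by
    rw [← Real.mul_rpow hc0.le (by positivity)]
    refine Real.rpow_le_rpow_of_nonpos (by positivity) ?_ (by have := Nat.cast_nonneg (α := ℝ) d; linarith)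
    have h3 : c * ‖ξ‖ ≤ u.1 * xiNorm d ξ :=
      mul_le_mul ((min_le_right _ _).trans hu) (norm_le_xiNorm d ξ) (norm_nonneg _)
        (ha.le.trans hu)
    have h4 : c ≤ 1 := min_le_left _ _
    linarith
  have hx0 : 0 ≤ xiNorm d ξ := Real.sqrt_nonneg _
  have hu0 : 0 < u.1 := ha.trans_le hu
  calc C * u.1 ^ (((0 : ℕ) : ℝ) - (j : ℝ)) * (1 + u.1 * xiNorm d ξ) ^ (-((d : ℝ) + 2))
      ≤ C * a ^ (-(j : ℝ)) * (c ^ (-((d : ℝ) + 2)) * (1 + ‖ξ‖) ^ (-((d : ℝ) + 2))) := by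
        gcongr
    _ = _ := by ring

lemma integrable_weight (d : ℕ) :
    Integrable (fun ξ : ℝ × Ed d => (1 + ‖ξ‖) ^ (-((d : ℝ) + 2))) := by
  apply integrable_one_add_norm
  have hfr : Module.finrank ℝ (ℝ × Ed d) = d + 1 := by simp [add_comm]
  rw [hfr]
  push_cast
  linarith

lemma sym_contDiff (d : ℕ) (σ : (ℝ × Ed d) → (ℝ × Ed d) → ℂ)
    (hsmooth : ContDiffOn ℝ (⊤ : ℕ∞) (fun p : (ℝ × Ed d) × (ℝ × Ed d) => σ p.1 p.2)
      {p : (ℝ × Ed d) × (ℝ × Ed d) | 0 < p.1.1}) (u : ℝ × Ed d) (hu : 0 < u.1) :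
    ContDiff ℝ (⊤ : ℕ∞) (σ u) := by
  rw [← contDiffOn_univ]
  exact hsmooth.comp (f := fun v : ℝ × Ed d => (u, v)) (contDiff_prodMk_right u).contDiffOn
    (fun v _ => hu)

lemma GT_bound (d : ℕ) (σ : (ℝ × Ed d) → (ℝ × Ed d) → ℂ)
    (hsmooth : ContDiffOn ℝ (⊤ : ℕ∞) (fun p : (ℝ × Ed d) × (ℝ × Ed d) => σ p.1 p.2)
      {p : (ℝ × Ed d) × (ℝ × Ed d) | 0 < p.1.1})
    (a : ℝ) (ha : 0 < a)
    (hb : ∀ j : ℕ, ∃ K : ℝ, 0 ≤ K ∧ ∀ u : ℝ × Ed d, a ≤ u.1 → ∀ ξ : ℝ × Ed d,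
      ‖iteratedFDeriv ℝ j (σ u) ξ‖ ≤ K * (1 + ‖ξ‖) ^ (-((d : ℝ) + 2))) :
    ∃ C : ℝ, 0 ≤ C ∧ ∀ u : ℝ × Ed d, a ≤ u.1 → ∀ z : ℝ × Ed d,
      ‖GT d (σ u) z‖ ≤ C * (1 + ‖z‖) ^ (-((d : ℝ) + 2)) := by
  choose K hK0 hK using hb
  set W := ∫ ξ : ℝ × Ed d, (1 + ‖ξ‖) ^ (-((d : ℝ) + 2)) with hW
  have hW0 : 0 ≤ W := integral_nonneg fun ξ => by positivity
  let T : ℕ → ℝ := fun n => (4 * π) ^ n * ∑ j ∈ Finset.range (n + 1), K j * W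
  have hT0 : ∀ n, 0 ≤ T n := fun n => by
    have : 0 ≤ ∑ j ∈ Finset.range (n + 1), K j * W :=
      Finset.sum_nonneg fun j _ => mul_nonneg (hK0 j) hW0
    positivity
  have hT : ∀ n, ∀ u : ℝ × Ed d, a ≤ u.1 → ∀ z : ℝ × Ed d, ‖z‖ ^ n * ‖GT d (σ u) z‖ ≤ T n := by
    intro n u hu z
    have hcd := sym_contDiff d σ hsmooth u (ha.trans_le hu)
    have hint : ∀ n : ℕ, Integrable (fun v => ‖iteratedFDeriv ℝ n (σ u) v‖) := by
      intro n
      refine Integrable.mono' ((integrable_weight d).const_mul (K n)) ?_ ?_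
      · exact ((hcd.continuous_iteratedFDeriv (m := n) (by exact_mod_cast le_top)).norm).aestronglyMeasurable
      · refine Eventually.of_forall fun ξ => ?_
        rw [norm_norm]
        exact hK n u hu ξ
    refine (GT_decay d (σ u) hcd hint n z).trans ?_
    simp only [T]
    gcongr with j hj
    rw [hW, ← integral_const_mul]
    exact integral_mono (hint j) ((integrable_weight d).const_mul (K j)) (hK j u hu)
  refine ⟨2 ^ (d + 1) * (T 0 + T (d + 2)), by have := hT0 0; have := hT0 (d + 2); positivity,
    fun u hu z => ?_⟩
  have h0 := hT 0 u hu z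
  have h1 := hT (d + 2) u hu z
  have h2 : (1 + ‖z‖) ^ (d + 2) ≤ 2 ^ (d + 1) * (1 + ‖z‖ ^ (d + 2)) := by
    have := add_pow_le zero_le_one (norm_nonneg z) (d + 2)
    simpa using this
  have e : (1 + ‖z‖) ^ (-((d : ℝ) + 2)) = ((1 + ‖z‖) ^ (d + 2))⁻¹ := by
    rw [Real.rpow_neg (by positivity), ← Real.rpow_natCast]
    push_cast
    rfl
  rw [e, ← div_eq_mul_inv, le_div_iff₀ (by positivity)]
  calc ‖GT d (σ u) z‖ * (1 + ‖z‖) ^ (d + 2)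
      ≤ ‖GT d (σ u) z‖ * (2 ^ (d + 1) * (1 + ‖z‖ ^ (d + 2))) := by gcongr
    _ = 2 ^ (d + 1) * (‖z‖ ^ 0 * ‖GT d (σ u) z‖ + ‖z‖ ^ (d + 2) * ‖GT d (σ u) z‖) := by ring
    _ ≤ _ := by gcongr

/-- The rescaled integrand. -/
def Hfun (d : ℕ) (σ : (ℝ × Ed d) → (ℝ × Ed d) → ℂ) (x₀ : ℝ × Ed d) (φ χ : ℝ × Ed d → ℝ)
    (h : ℝ) : ℝ × Ed d → ℂ :=
  {z : ℝ × Ed d | 0 < (x₀ - h • z).1}.indicator fun z =>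
    ((x₀.1 / (x₀ - h • z).1) ^ (((d : ℝ) + 1) / 2)) •
      (((2 * π) ^ (d + 1))⁻¹ • GT d (σ (x₀ - (h / 2) • z)) z) *
        ((χ (x₀ - h • z) : ℂ) * Complex.exp (Complex.I * Complex.ofReal (φ (x₀ - h • z) / h)))

lemma Hfun_measurable (d : ℕ) (σ : (ℝ × Ed d) → (ℝ × Ed d) → ℂ) (x₀ : ℝ × Ed d)
    (hx₀ : 0 < x₀.1) (φ χ : ℝ × Ed d → ℝ)
    (hσ : ContinuousOn (fun p : (ℝ × Ed d) × (ℝ × Ed d) => σ p.1 p.2)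
      {p : (ℝ × Ed d) × (ℝ × Ed d) | 0 < p.1.1})
    (hφ : ContinuousOn φ {p : ℝ × Ed d | 0 < p.1}) (hχ : Continuous χ) (h : ℝ) :
    AEStronglyMeasurable (Hfun d σ x₀ φ χ h) := by
  have hcont : Continuous fun z : ℝ × Ed d => x₀ - h • z := by fun_prop
  have hS : MeasurableSet {z : ℝ × Ed d | 0 < (x₀ - h • z).1} :=
    (isOpen_lt continuous_const hcont.fst).measurableSet
  unfold Hfun
  rw [aestronglyMeasurable_indicator_iff hS]
  refine AEStronglyMeasurable.mul ?_ ?_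
  · refine AEStronglyMeasurable.smul
      (f := fun z : ℝ × Ed d => (x₀.1 / (x₀ - h • z).1) ^ (((d : ℝ) + 1) / 2)) ?_
      (AEStronglyMeasurable.const_smul (f := fun z => GT d (σ (x₀ - (h / 2) • z)) z) ?_
        ((((2 * π) ^ (d + 1))⁻¹ : ℝ)))
    · have : Measurable fun z : ℝ × Ed d => (x₀.1 / (x₀ - h • z).1) ^ (((d : ℝ) + 1) / 2) :=
        (measurable_const.div hcont.fst.measurable).pow_const _
      exact this.aestronglyMeasurable
    · unfold GT
      have hc : ContinuousOn (fun p : (ℝ × Ed d) × (ℝ × Ed d) =>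
          Complex.exp (Complex.I * Complex.ofReal (epair d p.1 p.2)) *
            σ (x₀ - (h / 2) • p.1) p.2)
          ({z : ℝ × Ed d | 0 < (x₀ - h • z).1} ×ˢ (Set.univ : Set (ℝ × Ed d))) := by
        refine ContinuousOn.mul ?_ ?_
        · have := continuous_epair d
          fun_prop
        · refine hσ.comp (f := fun p : (ℝ × Ed d) × (ℝ × Ed d) => (x₀ - (h / 2) • p.1, p.2))
            (by fun_prop) ?_
          rintro p ⟨hp, -⟩
          simp only [Set.mem_setOf_eq, Prod.fst_sub, Prod.smul_fst, smul_eq_mul] at hp ⊢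
          linarith
      have hm := hc.aestronglyMeasurable (μ := (volume : Measure (ℝ × Ed d)).prod volume)
        (hS.prod MeasurableSet.univ)
      rw [← Measure.prod_restrict, Measure.restrict_univ] at hm
      exact hm.integral_prod_right'
  · refine ContinuousOn.aestronglyMeasurable ?_ hS
    have h1 : ContinuousOn (fun z : ℝ × Ed d => φ (x₀ - h • z)) {z | 0 < (x₀ - h • z).1} :=
      hφ.comp hcont.continuousOn fun z hz => hz
    have h2 : Continuous (fun z : ℝ × Ed d => χ (x₀ - h • z)) := hχ.comp hcont
    refine ContinuousOn.mul (Complex.continuous_ofReal.comp h2).continuousOn ?_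
    refine Complex.continuous_exp.comp_continuousOn (continuousOn_const.mul ?_)
    exact Complex.continuous_ofReal.comp_continuousOn (h1.div_const h)

lemma Hfun_bound (d : ℕ) (σ : (ℝ × Ed d) → (ℝ × Ed d) → ℂ) (x₀ : ℝ × Ed d)
    (hx₀ : 0 < x₀.1) (φ χ : ℝ × Ed d → ℝ) (C : ℝ) (hC0 : 0 ≤ C)
    (hC : ∀ u : ℝ × Ed d, x₀.1 / 2 ≤ u.1 → ∀ z : ℝ × Ed d,
      ‖GT d (σ u) z‖ ≤ C * (1 + ‖z‖) ^ (-((d : ℝ) + 2)))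
    (c₁ : ℝ) (hc₁ : 0 < c₁) (hχs : ∀ x : ℝ × Ed d, x.1 < c₁ → χ x = 0)
    (B : ℝ) (hB0 : 0 ≤ B) (hB : ∀ x, |χ x| ≤ B) (h : ℝ) (z : ℝ × Ed d) :
    ‖Hfun d σ x₀ φ χ h z‖ ≤ ((x₀.1 / c₁) ^ (((d : ℝ) + 1) / 2) * ((2 * π) ^ (d + 1))⁻¹ * C * B) *
      (1 + ‖z‖) ^ (-((d : ℝ) + 2)) := by
  unfold Hfun
  by_cases hz : z ∈ {z : ℝ × Ed d | 0 < (x₀ - h • z).1}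
  swap
  · rw [Set.indicator_of_notMem hz, norm_zero]
    positivity
  rw [Set.indicator_of_mem hz]
  by_cases hlt : (x₀ - h • z).1 < c₁
  · rw [hχs _ hlt]
    simp only [Complex.ofReal_zero, zero_mul, mul_zero, norm_zero]
    positivity
  push Not at hlt
  have hz' : 0 < (x₀ - h • z).1 := hz
  have hu : x₀.1 / 2 ≤ (x₀ - (h / 2) • z).1 := by
    simp only [Prod.fst_sub, Prod.smul_fst, smul_eq_mul] at hz' ⊢
    linarith
  have h1 := hC _ hu z
  have hexp : ‖Complex.exp (Complex.I * Complex.ofReal (φ (x₀ - h • z) / h))‖ = 1 := by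
    rw [mul_comm]; exact Complex.norm_exp_ofReal_mul_I _
  rw [norm_mul, norm_mul, norm_smul, norm_smul, hexp, mul_one, Complex.norm_real, Real.norm_eq_abs,
    Real.norm_eq_abs, Real.norm_eq_abs, abs_of_nonneg (by positivity : 0 ≤ ((2 * π) ^ (d + 1))⁻¹),
    abs_of_nonneg (Real.rpow_nonneg (div_nonneg hx₀.le hz'.le) _)]
  calc (x₀.1 / (x₀ - h • z).1) ^ (((d : ℝ) + 1) / 2) *
        (((2 * π) ^ (d + 1))⁻¹ * ‖GT d (σ (x₀ - (h / 2) • z)) z‖) * |χ (x₀ - h • z)|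
      ≤ (x₀.1 / c₁) ^ (((d : ℝ) + 1) / 2) *
        (((2 * π) ^ (d + 1))⁻¹ * (C * (1 + ‖z‖) ^ (-((d : ℝ) + 2)))) * B := by
        gcongr
        exact hB _
    _ = _ := by ring

lemma Hfun_tendsto (d : ℕ) (σ : (ℝ × Ed d) → (ℝ × Ed d) → ℂ) (x₀ ξ₀ : ℝ × Ed d)
    (hx₀ : 0 < x₀.1) (φ χ : ℝ × Ed d → ℝ)
    (hσ : ContinuousOn (fun p : (ℝ × Ed d) × (ℝ × Ed d) => σ p.1 p.2)
      {p : (ℝ × Ed d) × (ℝ × Ed d) | 0 < p.1.1})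
    (K : ℝ) (hK : ∀ u : ℝ × Ed d, x₀.1 / 2 ≤ u.1 → ∀ ξ : ℝ × Ed d,
      ‖σ u ξ‖ ≤ K * (1 + ‖ξ‖) ^ (-((d : ℝ) + 2)))
    (hcd : ∀ u : ℝ × Ed d, 0 < u.1 → Continuous (σ u))
    (hφd : DifferentiableAt ℝ φ x₀) (hφ0 : φ x₀ = 0)
    (hdφ : ∀ v : ℝ × Ed d, fderiv ℝ φ x₀ v = epair d v ξ₀)
    (hχ1 : ∀ᶠ x in nhds x₀, χ x = 1) (z : ℝ × Ed d) :
    Tendsto (fun h : ℝ => Hfun d σ x₀ φ χ h z) (𝓝[>] 0)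
      (𝓝 ((((2 * π) ^ (d + 1))⁻¹ : ℝ) •
        (Complex.exp (-(Complex.I * Complex.ofReal (epair d z ξ₀))) * GT d (σ x₀) z))) := by
  have hl : Tendsto (fun h : ℝ => x₀ - h • z) (𝓝[>] 0) (𝓝 x₀) := by
    have : Continuous fun h : ℝ => x₀ - h • z := by fun_prop
    have := this.tendsto 0
    simp only [zero_smul, sub_zero] at this
    exact this.mono_left nhdsWithin_le_nhds
  have hl2 : Tendsto (fun h : ℝ => x₀ - (h / 2) • z) (𝓝[>] 0) (𝓝 x₀) := by
    have : Continuous fun h : ℝ => x₀ - (h / 2) • z := by fun_prop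
    have := this.tendsto 0
    simp only [zero_div, zero_smul, sub_zero] at this
    exact this.mono_left nhdsWithin_le_nhds
  have hfst : Tendsto (fun x : ℝ × Ed d => x.1) (𝓝 x₀) (𝓝 x₀.1) := continuous_fst.tendsto _
  have hpos : ∀ᶠ h : ℝ in 𝓝[>] 0, 0 < (x₀ - h • z).1 :=
    (hfst.comp hl).eventually (lt_mem_nhds hx₀)
  have hpos2 : ∀ᶠ h : ℝ in 𝓝[>] 0, x₀.1 / 2 ≤ (x₀ - (h / 2) • z).1 :=
    ((hfst.comp hl2).eventually (lt_mem_nhds (half_lt_self hx₀))).mono fun _ h => le_of_lt h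
  have hone : ∀ᶠ h : ℝ in 𝓝[>] 0, χ (x₀ - h • z) = 1 := hl.eventually hχ1
  -- the weight
  have t1 : Tendsto (fun h : ℝ => (x₀.1 / (x₀ - h • z).1) ^ (((d : ℝ) + 1) / 2)) (𝓝[>] 0)
      (𝓝 1) := by
    have : Tendsto (fun h : ℝ => x₀.1 / (x₀ - h • z).1) (𝓝[>] 0) (𝓝 (x₀.1 / x₀.1)) :=
      tendsto_const_nhds.div (hfst.comp hl) hx₀.ne'
    rw [div_self hx₀.ne'] at this
    simpa using this.rpow_const (p := ((d : ℝ) + 1) / 2) (Or.inl one_ne_zero)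
  -- the kernel
  have t2 : Tendsto (fun h : ℝ => GT d (σ (x₀ - (h / 2) • z)) z) (𝓝[>] 0)
      (𝓝 (GT d (σ x₀) z)) := by
    unfold GT
    refine tendsto_integral_filter_of_dominated_convergence
      (fun ξ => K * (1 + ‖ξ‖) ^ (-((d : ℝ) + 2))) ?_ ?_ ((integrable_weight d).const_mul K) ?_
    · filter_upwards [hpos2] with h hh
      have h1 := hcd (x₀ - (h / 2) • z) (by linarith)
      have h2 : Continuous fun ξ => epair d z ξ :=
        (continuous_epair d).comp (Continuous.prodMk_right z)
      exact (by fun_prop : Continuous fun ξ => Complex.exp (Complex.I * Complex.ofReal (epair d z ξ)) *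
        σ (x₀ - (h / 2) • z) ξ).aestronglyMeasurable
    · filter_upwards [hpos2] with h hh
      refine Eventually.of_forall fun ξ => ?_
      rw [norm_mul, mul_comm Complex.I, Complex.norm_exp_ofReal_mul_I, one_mul]
      exact hK _ hh ξ
    · refine Eventually.of_forall fun ξ => ?_
      refine tendsto_const_nhds.mul ?_
      have hop : IsOpen {p : (ℝ × Ed d) × (ℝ × Ed d) | 0 < p.1.1} :=
        isOpen_lt continuous_const continuous_fst.fst
      have hca : ContinuousAt (fun p : (ℝ × Ed d) × (ℝ × Ed d) => σ p.1 p.2) (x₀, ξ) :=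
        hσ.continuousAt (hop.mem_nhds hx₀)
      exact hca.tendsto.comp (hl2.prodMk_nhds tendsto_const_nhds)
  -- the phase
  have t3 : Tendsto (fun h : ℝ => φ (x₀ - h • z) / h) (𝓝[>] 0) (𝓝 (-epair d z ξ₀)) := by
    have hd1 : HasDerivAt (fun h : ℝ => x₀ - h • z) (-z) 0 := by
      simpa using ((hasDerivAt_id (0 : ℝ)).smul_const z).const_sub x₀
    have hφ' : HasFDerivAt φ (fderiv ℝ φ x₀) (x₀ - (0 : ℝ) • z) := by
      simpa using hφd.hasFDerivAt
    have hd2 : HasDerivAt (fun h : ℝ => φ (x₀ - h • z)) (-epair d z ξ₀) 0 := by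
      have := hφ'.comp_hasDerivAt (0 : ℝ) hd1
      rw [map_neg, hdφ] at this
      exact this
    have := hd2.tendsto_slope_zero_right
    refine this.congr fun h => ?_
    simp [hφ0, div_eq_inv_mul]
  have t4 : Tendsto (fun h : ℝ => Complex.exp (Complex.I * Complex.ofReal (φ (x₀ - h • z) / h)))
      (𝓝[>] 0) (𝓝 (Complex.exp (-(Complex.I * Complex.ofReal (epair d z ξ₀))))) := by
    have : Continuous fun t : ℝ => Complex.exp (Complex.I * Complex.ofReal t) := by fun_prop
    have h7 := (this.tendsto _).comp t3
    have e : Complex.exp (Complex.I * Complex.ofReal (-epair d z ξ₀)) =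
        Complex.exp (-(Complex.I * Complex.ofReal (epair d z ξ₀))) := by
      rw [Complex.ofReal_neg, mul_neg]
    rw [← e]
    exact h7
  have t5 := (t1.smul (t2.const_smul ((((2 * π) ^ (d + 1))⁻¹ : ℝ)))).mul t4
  have e : ((1 : ℝ) • ((((2 * π) ^ (d + 1))⁻¹ : ℝ) • GT d (σ x₀) z)) *
      Complex.exp (-(Complex.I * Complex.ofReal (epair d z ξ₀))) =
      (((2 * π) ^ (d + 1))⁻¹ : ℝ) •
        (Complex.exp (-(Complex.I * Complex.ofReal (epair d z ξ₀))) * GT d (σ x₀) z) := by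
    rw [one_smul, smul_mul_assoc, mul_comm (GT d (σ x₀) z)]
  rw [e] at t5
  refine t5.congr' ?_
  filter_upwards [hpos, hone] with h h1 h2
  rw [Hfun, Set.indicator_of_mem (by exact h1), h2]
  simp

lemma cuspOp_eq (d : ℕ) (Λ : AddSubgroup (Ed d)) [Countable Λ]
    (D : Set (Ed d)) (hD : IsAddFundamentalDomain Λ D volume)
    (σ : (ℝ × Ed d) → (ℝ × Ed d) → ℂ) (x₀ : ℝ × Ed d) (φ χ : ℝ × Ed d → ℝ)
    (hφper : ∀ k ∈ Λ, ∀ x : ℝ × Ed d, φ (x.1, x.2 + k) = φ x)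
    (hχper : ∀ k ∈ Λ, ∀ x : ℝ × Ed d, χ (x.1, x.2 + k) = χ x)
    (h : ℝ) (hh : 0 < h) (hint : Integrable (Hfun d σ x₀ φ χ h)) :
    cuspOp d Λ D h σ
      (fun x : ℝ × Ed d => (χ x : ℂ) * Complex.exp (Complex.I * Complex.ofReal (φ x / h))) x₀ =
      ∫ z, Hfun d σ x₀ φ χ h z := by
  let S : Set (ℝ × Ed d) := {x | 0 < x.1}
  have hS : MeasurableSet S := (isOpen_lt continuous_const continuous_fst).measurableSet
  let F : ℝ × Ed d → ℂ := fun x' =>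
    ((x₀.1 / x'.1) ^ (((d : ℝ) + 1) / 2)) • weylKernel d h σ x₀ x' *
      ((χ x' : ℂ) * Complex.exp (Complex.I * Complex.ofReal (φ x' / h)))
  have hFH : ∀ z, S.indicator F (x₀ - h • z) = ((h ^ (d + 1))⁻¹ : ℝ) • Hfun d σ x₀ φ χ h z := by
    intro z
    unfold Hfun
    by_cases hz : 0 < (x₀ - h • z).1
    · rw [Set.indicator_of_mem (by exact hz), Set.indicator_of_mem (by exact hz)]
      simp only [F]
      have hw : weylKernel d h σ x₀ (x₀ - h • z) =
          ((h ^ (d + 1))⁻¹ : ℝ) • ((((2 * π) ^ (d + 1))⁻¹ : ℝ) •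
            GT d (σ (x₀ - (h / 2) • z)) z) := by
        unfold weylKernel GT
        rw [smul_smul, ← mul_inv, ← mul_pow, mul_comm h]
        congr 2
        ext ξ
        have e1 : epair d (x₀ - (x₀ - h • z)) ξ / h = epair d z ξ := by
          rw [sub_sub_cancel, epair_smul_left, mul_div_cancel_left₀ _ hh.ne']
        have e2 : (1 / 2 : ℝ) • (x₀ + (x₀ - h • z)) = x₀ - (h / 2) • z := by
          module
        rw [e1, e2]
      rw [hw, smul_comm, smul_mul_assoc]
    · rw [Set.indicator_of_notMem (by exact hz), Set.indicator_of_notMem (by exact hz), smul_zero]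
  have hFi : Integrable (S.indicator F) := by
    have h1 : Integrable (fun z => S.indicator F (x₀ - h • z)) := by
      simp only [hFH]
      exact hint.smul ((h ^ (d + 1))⁻¹ : ℝ)
    have h2 : Integrable (fun w => S.indicator F (x₀ - w)) :=
      (integrable_comp_smul_iff volume (fun w => S.indicator F (x₀ - w)) hh.ne').1 h1
    simpa using h2.comp_sub_left x₀
  have e1 : cuspOp d Λ D h σ
      (fun x : ℝ × Ed d => (χ x : ℂ) * Complex.exp (Complex.I * Complex.ofReal (φ x / h))) x₀ =
      ∫ x in cusp d D, ∑' k : Λ, F (x.1, x.2 + (k : Ed d)) := by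
    unfold cuspOp cuspKernel
    congr 1
    ext x
    simp only [F]
    rw [← tsum_const_smul'', ← tsum_mul_right]
    congr 1
    ext k
    rw [hφper k k.2, hχper k k.2]
  rw [e1, unfold_integral d Λ D hD F ((integrable_indicator_iff hS).1 hFi),
    ← integral_indicator hS]
  have e2 := Measure.integral_comp_smul (volume : Measure (ℝ × Ed d))
    (fun w => S.indicator F (x₀ - w)) h
  simp only [hFH] at e2
  rw [integral_smul, integral_sub_left_eq_self (S.indicator F) volume x₀] at e2
  have hfr : Module.finrank ℝ (ℝ × Ed d) = d + 1 := by simp [add_comm]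
  rw [hfr, abs_of_pos (by positivity)] at e2
  have hne : ((h ^ (d + 1))⁻¹ : ℝ) ≠ 0 := by positivity
  exact (smul_right_injective ℂ hne e2).symm
/-- **The quantization has the right principal symbol.** For a symbol `σ` of
order `-∞` on the cusp (Λ-periodic in `θ`, with `|∂_x^β ∂_ξ^α σ| ≤ C y^{|β|-|α|}(1+y|ξ|)^{-M}`
for all `α, β, M`), a point `x₀ ∈ Z_Λ`, a covector `ξ₀`, a smooth real phase `φ` with
`φ(x₀) = 0`, `dφ(x₀) = ξ₀`, and a cutoff `χ ∈ C_c^∞(Z_Λ)` equal to `1` near `x₀`, one has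
`Op_h(σ)(χ e^{iφ/h})(x₀) → σ(x₀,ξ₀)` as `h → 0⁺`. -/
theorem stmt8 (d : ℕ) (hd : 1 ≤ d) (Λ : AddSubgroup (Ed d)) (hΛ : DiscreteTopology Λ)
    (D : Set (Ed d)) (hD : IsAddFundamentalDomain Λ D volume) (hDvol : volume D = 1)
    (σ : (ℝ × Ed d) → (ℝ × Ed d) → ℂ)
    (hper : ∀ k ∈ Λ, ∀ (x : ℝ × Ed d) (ξ : ℝ × Ed d), σ (x.1, x.2 + k) ξ = σ x ξ)
    (hsmooth : ContDiffOn ℝ (⊤ : ℕ∞) (fun p : (ℝ × Ed d) × (ℝ × Ed d) => σ p.1 p.2)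
      {p : (ℝ × Ed d) × (ℝ × Ed d) | 0 < p.1.1})
    (hbounds : ∀ (bx bξ : ℕ) (M : ℝ), ∃ C : ℝ, 0 < C ∧
      ∀ x : ℝ × Ed d, 0 < x.1 → ∀ ξ : ℝ × Ed d,
        ‖iteratedFDeriv ℝ bx
            (fun u : ℝ × Ed d => iteratedFDeriv ℝ bξ (fun v : ℝ × Ed d => σ u v) ξ) x‖ ≤
          C * x.1 ^ ((bx : ℝ) - (bξ : ℝ)) * (1 + x.1 * xiNorm d ξ) ^ (-M))
    (x₀ ξ₀ : ℝ × Ed d) (hx₀ : 0 < x₀.1)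
    (φ : ℝ × Ed d → ℝ)
    (hφreg : ContDiffOn ℝ (⊤ : ℕ∞) φ {p : ℝ × Ed d | 0 < p.1})
    (hφper : ∀ k ∈ Λ, ∀ x : ℝ × Ed d, φ (x.1, x.2 + k) = φ x)
    (hφ0 : φ x₀ = 0)
    (hdφ : ∀ v : ℝ × Ed d, fderiv ℝ φ x₀ v = epair d v ξ₀)
    (χ : ℝ × Ed d → ℝ)
    (hχreg : ContDiff ℝ (⊤ : ℕ∞) χ)
    (hχper : ∀ k ∈ Λ, ∀ x : ℝ × Ed d, χ (x.1, x.2 + k) = χ x)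
    (hχsupp : ∃ c₁ c₂ : ℝ, 0 < c₁ ∧ ∀ x : ℝ × Ed d, x.1 < c₁ ∨ c₂ < x.1 → χ x = 0)
    (hχ1 : ∀ᶠ x in nhds x₀, χ x = 1) :
    Filter.Tendsto
      (fun h : ℝ =>
        cuspOp d Λ D h σ
          (fun x : ℝ × Ed d => (χ x : ℂ) * Complex.exp (Complex.I * Complex.ofReal (φ x / h)))
          x₀)
      (nhdsWithin (0 : ℝ) (Set.Ioi 0)) (nhds (σ x₀ ξ₀)) := by
  have hcΛ : Countable Λ := by
    have := hΛ
    exact countable_of_Lindelof_of_discrete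
  obtain ⟨c₁, c₂, hc₁, hχs⟩ := hχsupp
  obtain ⟨B, hB0, hB⟩ := chi_bounded d Λ D hD hDvol χ hχreg.continuous hχper c₁ c₂ hχs
  have hb := sym_bound d σ hbounds (x₀.1 / 2) (half_pos hx₀)
  obtain ⟨C, hC0, hC⟩ := GT_bound d σ hsmooth (x₀.1 / 2) (half_pos hx₀) hb
  obtain ⟨K, hK0, hK⟩ := hb 0
  simp only [norm_iteratedFDeriv_zero] at hK
  have hhalf : x₀.1 / 2 ≤ x₀.1 := half_le_self hx₀.le
  have hop : IsOpen {p : ℝ × Ed d | 0 < p.1} := isOpen_lt continuous_const continuous_fst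
  have hφd : DifferentiableAt ℝ φ x₀ :=
    (hφreg.contDiffAt (hop.mem_nhds hx₀)).differentiableAt (by simp)
  have hcd : ∀ u : ℝ × Ed d, 0 < u.1 → Continuous (σ u) := fun u hu =>
    (sym_contDiff d σ hsmooth u hu).continuous
  have hmeas := Hfun_measurable d σ x₀ hx₀ φ χ hsmooth.continuousOn hφreg.continuousOn
    hχreg.continuous
  have hbd := Hfun_bound d σ x₀ hx₀ φ χ C hC0 hC c₁ hc₁ (fun x hx => hχs x (Or.inl hx)) B hB0 hB
  have hwt := (integrable_weight d).const_mul
    ((x₀.1 / c₁) ^ (((d : ℝ) + 1) / 2) * ((2 * π) ^ (d + 1))⁻¹ * C * B)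
  have hσi : Integrable (σ x₀) :=
    Integrable.mono' ((integrable_weight d).const_mul K) (hcd x₀ hx₀).aestronglyMeasurable
      (Eventually.of_forall fun ξ => hK x₀ hhalf ξ)
  have hGm : AEStronglyMeasurable (GT d (σ x₀)) := by
    unfold GT
    have h1 : Continuous fun p : (ℝ × Ed d) × (ℝ × Ed d) =>
        Complex.exp (Complex.I * Complex.ofReal (epair d p.1 p.2)) * σ x₀ p.2 := by
      have := continuous_epair d
      have := hcd x₀ hx₀
      fun_prop
    exact (h1.aestronglyMeasurable
      (μ := (volume : Measure (ℝ × Ed d)).prod volume)).integral_prod_right'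
  have hGi : Integrable (GT d (σ x₀)) :=
    Integrable.mono' ((integrable_weight d).const_mul C) hGm
      (Eventually.of_forall fun z => hC x₀ hhalf z)
  have hlim : Tendsto (fun h : ℝ => ∫ z, Hfun d σ x₀ φ χ h z) (𝓝[>] 0)
      (𝓝 (∫ z, (((2 * π) ^ (d + 1))⁻¹ : ℝ) •
        (Complex.exp (-(Complex.I * Complex.ofReal (epair d z ξ₀))) * GT d (σ x₀) z))) :=
    tendsto_integral_filter_of_dominated_convergence _
      (Eventually.of_forall hmeas)
      (Eventually.of_forall fun h => Eventually.of_forall fun z => hbd h z) hwt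
      (Eventually.of_forall fun z => Hfun_tendsto d σ x₀ ξ₀ hx₀ φ χ hsmooth.continuousOn K hK hcd
        hφd hφ0 hdφ hχ1 z)
  rw [integral_smul, GT_inversion d (σ x₀) (hcd x₀ hx₀) hσi hGi ξ₀, smul_smul,
    inv_mul_cancel₀ (by positivity), one_smul] at hlim
  refine hlim.congr' ?_
  filter_upwards [self_mem_nhdsWithin] with h hh
  exact (cuspOp_eq d Λ D hD σ x₀ φ χ hφper hχper h hh
    (Integrable.mono' hwt (hmeas h) (Eventually.of_forall fun z => hbd h z))).symm
end
end
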